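/- arXiv:math/0209352 — 2 statements merged into one kernel-verified Lean document; each statement's English description precedes it below -/
import Mathlib

section
/- Morrey–Sobolev embedding: for n/2 ≤ p < n and 1/q = 1/p − 1/n, every u ∈ M^p_{2,1}([0,1]ⁿ) satisfies ‖u‖_{M^q_4([0,1]ⁿ)} ≤ C ‖u‖_{M^p_{2,1}([0,1]ⁿ)}. -/
open MeasureTheory Metric

noncomputable def morreyNorm (n : ℕ) (p q : ℝ) (Ω : Set (EuclideanSpace ℝ (Fin n)))
    (f : EuclideanSpace ℝ (Fin n) → ℝ) : ℝ :=
  ⨆ x₀ : EuclideanSpace ℝ (Fin n), ⨆ r : Set.Ioc (0:ℝ) 1,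
    (r : ℝ) ^ ((n : ℝ) * (1/p - 1/q)) *
      (∫ y in Metric.ball x₀ (r : ℝ) ∩ Ω, |f y| ^ q) ^ (1/q)

/-- The unit cube [0,1]ⁿ. -/
def unitCube (n : ℕ) : Set (EuclideanSpace ℝ (Fin n)) :=
  {x | ∀ i, x i ∈ Set.Icc (0:ℝ) 1}

/-- The Morrey–Sobolev norm M^p_{2,1}. -/
noncomputable def morreySobolev1 (n : ℕ) (p : ℝ) (Ω : Set (EuclideanSpace ℝ (Fin n)))
    (u : EuclideanSpace ℝ (Fin n) → ℝ) : ℝ :=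
  morreyNorm n p 2 Ω u + morreyNorm n p 2 Ω (fun y => ‖fderiv ℝ u y‖)


abbrev EE (n : ℕ) := EuclideanSpace ℝ (Fin n)

lemma sq_lintegral_le {α : Type*} [MeasurableSpace α] (μ : Measure α) (f : α → ENNReal)
    (hf : Measurable f) : (∫⁻ a, f a ∂μ) ^ 2 ≤ μ Set.univ * ∫⁻ a, f a ^ 2 ∂μ := by
  have h := ENNReal.lintegral_mul_le_Lp_mul_Lq μ (p := 2) (q := 2) Real.HolderConjugate.two_two
    hf.aemeasurable (g := fun _ => 1) aemeasurable_const
  simp only [Pi.mul_apply, mul_one, ENNReal.one_rpow, lintegral_const, one_mul] at h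
  calc (∫⁻ a, f a ∂μ) ^ 2 ≤ ((∫⁻ a, f a ^ (2:ℝ) ∂μ) ^ (1/2:ℝ) * (μ Set.univ) ^ (1/2:ℝ)) ^ 2 := by
        gcongr
    _ = μ Set.univ * ∫⁻ a, f a ^ 2 ∂μ := by
        rw [mul_pow, ← ENNReal.rpow_natCast, ← ENNReal.rpow_natCast, ← ENNReal.rpow_mul,
          ← ENNReal.rpow_mul]
        norm_num [mul_comm]

lemma unitCube_eq (n : ℕ) : unitCube n =
    (MeasurableEquiv.toLp 2 (Fin n → ℝ)).symm ⁻¹' (Set.Icc (fun _ => 0) (fun _ => 1)) := by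
  ext x
  simp only [unitCube, Set.mem_ofPred_eq, Set.mem_preimage, Set.mem_Icc, Pi.le_def]
  constructor
  · intro h
    exact ⟨fun i => (h i).1, fun i => (h i).2⟩
  · intro h i
    exact ⟨h.1 i, h.2 i⟩

lemma measurableSet_unitCube (n : ℕ) : MeasurableSet (unitCube n) := by
  rw [unitCube_eq]
  exact (MeasurableEquiv.measurable _) measurableSet_Icc

lemma volume_unitCube (n : ℕ) : volume (unitCube n) = 1 := by
  rw [unitCube_eq, (EuclideanSpace.volume_preserving_symm_measurableEquiv_toLp
    (Fin n)).measure_preimage measurableSet_Icc.nullMeasurableSet, Real.volume_Icc_pi]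
  simp

lemma isCompact_unitCube (n : ℕ) : IsCompact (unitCube n) := by
  have h : unitCube n = (EuclideanSpace.equiv (Fin n) ℝ).toHomeomorph ⁻¹'
      (Set.Icc (fun _ => 0) (fun _ => 1)) := by
    rw [unitCube_eq]; rfl
  rw [h, Homeomorph.isCompact_preimage]
  exact isCompact_Icc

lemma convex_unitCube (n : ℕ) {x y : EE n} (hx : x ∈ unitCube n) (hy : y ∈ unitCube n) {s : ℝ}
    (h0 : 0 ≤ s) (h1 : s ≤ 1) : x + s • (y - x) ∈ unitCube n := by
  intro i
  have a := hx i
  have b := hy i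
  simp only [Set.mem_Icc] at a b
  simp only [PiLp.add_apply, PiLp.smul_apply, PiLp.sub_apply, smul_eq_mul, Set.mem_Icc]
  constructor <;> nlinarith

lemma norm_sub_unitCube (n : ℕ) {x y : EE n} (hx : x ∈ unitCube n) (hy : y ∈ unitCube n) :
    ‖y - x‖ ≤ √n := by
  rw [EuclideanSpace.norm_eq]
  apply Real.sqrt_le_sqrt
  calc ∑ i, ‖(y - x) i‖ ^ 2 ≤ ∑ i : Fin n, (1:ℝ) := by
        apply Finset.sum_le_sum
        intro i _
        have a := hx i
        have b := hy i
        simp only [Set.mem_Icc] at a b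
        rw [PiLp.sub_apply, Real.norm_eq_abs, sq_abs]
        nlinarith
    _ = n := by simp

lemma lintegral_affine (n : ℕ) (F : EE n → ENNReal) (hF : Measurable F) (c : ℝ) (hc : 0 < c)
    (b : EE n) : ∫⁻ x, F (c • x + b) = ENNReal.ofReal ((c ^ n)⁻¹) * ∫⁻ x, F x := by
  have h1 : ∫⁻ x, F (c • x + b) = ∫⁻ z, F (z + b) ∂(Measure.map (fun x => c • x) volume) := by
    rw [lintegral_map (by fun_prop) (by fun_prop)]
  rw [h1, Measure.map_addHaar_smul volume hc.ne', lintegral_smul_measure,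
    lintegral_add_right_eq_self (fun z => F z) b, abs_of_pos (by simp; positivity)]
  simp

lemma lintegral_affine_le (n : ℕ) (F : EE n → ENNReal) (hF : Measurable F) (c : ℝ) (hc : 0 < c)
    (b : EE n) (S T : Set (EE n)) (hS : MeasurableSet S) (hT : MeasurableSet T)
    (hST : ∀ x ∈ S, c • x + b ∈ T) :
    ∫⁻ x in S, F (c • x + b) ≤ ENNReal.ofReal ((c ^ n)⁻¹) * ∫⁻ x in T, F x := by
  rw [← lintegral_indicator hT, ← lintegral_affine n _ (hF.indicator hT) c hc b,
    ← lintegral_indicator hS]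
  apply lintegral_mono
  intro x
  by_cases hx : x ∈ S
  · simp [hx, hST x hx]
  · simp [hx]

lemma ftc_le (n : ℕ) (g : EE n → ℝ) (hg : ContDiff ℝ 1 g) (x v : EE n) (a b : ℝ) (hab : a ≤ b) :
    ‖g (x + b • v) - g (x + a • v)‖ₑ ≤
      ∫⁻ s in Set.Icc a b, ‖fderiv ℝ g (x + s • v)‖ₑ * ‖v‖ₑ := by
  have hl : ContDiff ℝ 1 (fun s : ℝ => g (x + s • v)) := by fun_prop
  refine (enorm_sub_le_lintegral_deriv_of_contDiffOn_Icc hl.contDiffOn hab).trans ?_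
  apply lintegral_mono
  intro s
  have hd : HasDerivAt (fun s : ℝ => g (x + s • v)) (fderiv ℝ g (x + s • v) v) s := by
    have h1 : HasFDerivAt g (fderiv ℝ g (x + s • v)) (x + s • v) :=
      (hg.differentiable (by simp) _).hasFDerivAt
    have h2 : HasDerivAt (fun s : ℝ => x + s • v) v s := by
      simpa using ((hasDerivAt_id s).smul_const v).const_add x
    exact h1.comp_hasDerivAt s h2
  simp only
  rw [hd.deriv]
  exact ContinuousLinearMap.le_opENorm _ _

/-- change of variables in the base point -/
lemma cov_x (n : ℕ) (hn : 4 ≤ n) (F : EE n → ENNReal) (hF : Measurable F) (x₀ y : EE n) (r s : ℝ)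
    (hr1 : r ≤ 1) (hy : y ∈ unitCube n) (h0 : 0 ≤ s) (hs : s ≤ r / (2 * √n)) :
    ∫⁻ x in ball x₀ r ∩ unitCube n, F (x + s • (y - x)) ≤
      2 ^ n * ∫⁻ x in ball x₀ (2 * r) ∩ unitCube n, F x := by
  have hsn : (2:ℝ) ≤ √n := by
    rw [show (2:ℝ) = √4 by rw [show (4:ℝ) = 2^2 by norm_num]; simp]
    exact Real.sqrt_le_sqrt (by exact_mod_cast hn)
  rw [le_div_iff₀ (by positivity)] at hs
  have hs2 : s ≤ 1 / 2 := by nlinarith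
  have key : ∀ x : EE n, x + s • (y - x) = (1 - s) • x + s • y := by
    intro x; module
  simp_rw [key]
  refine (lintegral_affine_le n F hF (1 - s) (by linarith) (s • y) _
    (ball x₀ (2 * r) ∩ unitCube n)
    (measurableSet_ball.inter (measurableSet_unitCube n))
    (measurableSet_ball.inter (measurableSet_unitCube n)) ?_).trans ?_
  · rintro x ⟨hx, hxc⟩
    rw [← key]
    refine ⟨?_, convex_unitCube n hxc hy h0 (by linarith)⟩
    rw [mem_ball_iff_norm] at hx ⊢
    have := norm_sub_unitCube n hxc hy
    calc ‖x + s • (y - x) - x₀‖ = ‖(x - x₀) + s • (y - x)‖ := by congr 1; abel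
      _ ≤ ‖x - x₀‖ + s * ‖y - x‖ := by
        refine (norm_add_le _ _).trans ?_
        rw [norm_smul, Real.norm_of_nonneg h0]
      _ < 2 * r := by nlinarith
  · gcongr
    rw [show (2:ENNReal)^n = ENNReal.ofReal (2^n) by
      rw [ENNReal.ofReal_pow (by norm_num)]; simp]
    apply ENNReal.ofReal_le_ofReal
    rw [← inv_pow]
    have : (1 - s)⁻¹ ≤ 2 := by
      rw [inv_le_comm₀ (by linarith) (by norm_num)]; linarith
    have h3 : 0 ≤ (1 - s)⁻¹ := by rw [inv_nonneg]; linarith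
    gcongr

/-- change of variables in the averaging variable -/
lemma cov_y (n : ℕ) (hn : 4 ≤ n) (F : EE n → ENNReal) (hF : Measurable F) (x : EE n) (s : ℝ)
    (hx : x ∈ unitCube n) (h0 : 0 < s) (hs : s ≤ 1) :
    ∫⁻ y in unitCube n, F (x + s • (y - x)) ≤
      ENNReal.ofReal ((s ^ n)⁻¹) * ∫⁻ y in ball x (2 * √n * s) ∩ unitCube n, F y := by
  have hsn : (0:ℝ) < √n := Real.sqrt_pos.2 (by exact_mod_cast (by omega : 0 < n))
  have key : ∀ y : EE n, x + s • (y - x) = s • y + (1 - s) • x := by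
    intro y; module
  simp_rw [key]
  refine lintegral_affine_le n F hF s h0 _ _ _ (measurableSet_unitCube n)
    (measurableSet_ball.inter (measurableSet_unitCube n)) ?_
  intro y hy
  rw [← key]
  refine ⟨?_, convex_unitCube n hx hy h0.le hs⟩
  rw [mem_ball_iff_norm, add_sub_cancel_left, norm_smul, Real.norm_of_nonneg h0.le]
  have := norm_sub_unitCube n hx hy
  nlinarith [mul_pos hsn h0]

lemma volume_ball_toReal (n : ℕ) (hn : 4 ≤ n) (x : EE n) (R : ℝ) (hR : 0 < R) :
    volume (ball x R) = ENNReal.ofReal (R ^ n * (volume (ball (0 : EE n) 1)).toReal) := by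
  have : Nontrivial (EE n) := by
    have : Nonempty (Fin n) := ⟨⟨0, by omega⟩⟩
    infer_instance
  rw [Measure.addHaar_ball volume x hR.le, ENNReal.ofReal_mul (by positivity),
    ENNReal.ofReal_toReal measure_ball_lt_top.ne]
  simp

lemma integrableOn_pow (n : ℕ) (f : EE n → ℝ) (hf : Continuous f) (q : ℝ) (hq : 0 ≤ q)
    (x : EE n) (R : ℝ) :
    IntegrableOn (fun y => |f y| ^ q) (ball x R ∩ unitCube n) := by
  have hc : Continuous (fun y => |f y| ^ q) := hf.abs.rpow_const (fun _ => Or.inr hq)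
  exact (hc.continuousOn.integrableOn_compact (isCompact_unitCube n)).mono_set
    Set.inter_subset_right

lemma morrey_bound (n : ℕ) (hn : 4 ≤ n) (p : ℝ) (hp : 0 < p) (f : EE n → ℝ) (hf : Continuous f) :
    0 ≤ morreyNorm n p 2 (unitCube n) f ∧
    ∀ (x : EE n) (R : ℝ), 0 < R → R ≤ 1 →
      ∫⁻ y in ball x R ∩ unitCube n, ‖f y‖ₑ ^ 2 ≤
        ENNReal.ofReal (R ^ ((n:ℝ) - 2 * (n / p)) * (morreyNorm n p 2 (unitCube n) f) ^ 2) := by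
  have hn0 : (0:ℝ) < n := by exact_mod_cast (by omega : 0 < n)
  obtain ⟨K, hK⟩ := (isCompact_unitCube n).exists_bound_of_continuousOn hf.continuousOn
  set κ := (volume (ball (0 : EE n) 1)).toReal with hκ
  have hκ0 : 0 ≤ κ := ENNReal.toReal_nonneg
  have hI0 : ∀ (x : EE n) (R : ℝ), 0 ≤ ∫ y in ball x R ∩ unitCube n, |f y| ^ (2:ℝ) := by
    intro x R
    apply integral_nonneg
    intro y; positivity
  have hterm : ∀ (x : EE n) (R : ℝ), 0 < R → R ≤ 1 →
      R ^ ((n : ℝ) * (1/p - 1/2)) * (∫ y in ball x R ∩ unitCube n, |f y| ^ (2:ℝ)) ^ (1/2:ℝ)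
        ≤ (K ^ 2 * κ) ^ (1/2:ℝ) := by
    intro x R h0 h1
    have hle : ∫ y in ball x R ∩ unitCube n, |f y| ^ (2:ℝ) ≤ K ^ 2 * (R ^ n * κ) := by
      have hfin : volume (ball x R ∩ unitCube n) ≠ ⊤ :=
        (measure_mono Set.inter_subset_left).trans_lt measure_ball_lt_top |>.ne
      have : ∫ y in ball x R ∩ unitCube n, |f y| ^ (2:ℝ) ≤
          ∫ y in ball x R ∩ unitCube n, K ^ 2 := by
        apply setIntegral_mono_on (integrableOn_pow n f hf 2 (by norm_num) x R)
          (integrableOn_const hfin) (measurableSet_ball.inter (measurableSet_unitCube n))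
        intro y hy
        have := hK y hy.2
        rw [Real.norm_eq_abs] at this
        rw [Real.rpow_two]
        gcongr
      refine this.trans ?_
      rw [setIntegral_const, smul_eq_mul, mul_comm]
      gcongr
      rw [measureReal_def]
      apply ENNReal.toReal_le_of_le_ofReal (by positivity)
      rw [hκ, ← volume_ball_toReal n hn x R h0]
      exact measure_mono Set.inter_subset_left
    calc R ^ ((n : ℝ) * (1/p - 1/2)) * (∫ y in ball x R ∩ unitCube n, |f y| ^ (2:ℝ)) ^ (1/2:ℝ)
        ≤ R ^ ((n : ℝ) * (1/p - 1/2)) * (K ^ 2 * (R ^ n * κ)) ^ (1/2:ℝ) := by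
          gcongr
      _ = R ^ ((n : ℝ) / p) * (K ^ 2 * κ) ^ (1/2:ℝ) := by
          rw [show K ^ 2 * (R ^ n * κ) = R ^ n * (K ^ 2 * κ) by ring,
            Real.mul_rpow (by positivity) (by positivity), ← mul_assoc, ← Real.rpow_natCast,
            ← Real.rpow_mul h0.le, ← Real.rpow_add h0]
          congr 2
          ring
      _ ≤ 1 * (K ^ 2 * κ) ^ (1/2:ℝ) := by
          gcongr
          exact Real.rpow_le_one h0.le h1 (by positivity)
      _ = _ := one_mul _
  have : Nonempty (Set.Ioc (0:ℝ) 1) := ⟨⟨1, by norm_num⟩⟩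
  have hin : ∀ x : EE n, BddAbove (Set.range fun r : Set.Ioc (0:ℝ) 1 =>
      (r:ℝ) ^ ((n : ℝ) * (1/p - 1/2)) *
        (∫ y in ball x (r:ℝ) ∩ unitCube n, |f y| ^ (2:ℝ)) ^ (1/2:ℝ)) := by
    intro x
    refine ⟨(K ^ 2 * κ) ^ (1/2:ℝ), ?_⟩
    rintro _ ⟨r, rfl⟩
    exact hterm x r r.2.1 r.2.2
  have hout : BddAbove (Set.range fun x : EE n => ⨆ r : Set.Ioc (0:ℝ) 1,
      (r:ℝ) ^ ((n : ℝ) * (1/p - 1/2)) *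
        (∫ y in ball x (r:ℝ) ∩ unitCube n, |f y| ^ (2:ℝ)) ^ (1/2:ℝ)) := by
    refine ⟨(K ^ 2 * κ) ^ (1/2:ℝ), ?_⟩
    rintro _ ⟨x, rfl⟩
    exact ciSup_le fun r => hterm x r r.2.1 r.2.2
  have hN : ∀ (x : EE n) (R : ℝ), 0 < R → R ≤ 1 →
      R ^ ((n : ℝ) * (1/p - 1/2)) * (∫ y in ball x R ∩ unitCube n, |f y| ^ (2:ℝ)) ^ (1/2:ℝ)
        ≤ morreyNorm n p 2 (unitCube n) f := by
    intro x R h0 h1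
    exact (le_ciSup (hin x) ⟨R, h0, h1⟩).trans (le_ciSup hout x)
  have hN0 : 0 ≤ morreyNorm n p 2 (unitCube n) f := by
    refine le_trans ?_ (hN 0 1 one_pos le_rfl)
    have := hI0 0 1
    positivity
  refine ⟨hN0, ?_⟩
  intro x R h0 h1
  have h := hN x R h0 h1
  have hI := hI0 x R
  have heq : ∫⁻ y in ball x R ∩ unitCube n, ‖f y‖ₑ ^ 2 =
      ENNReal.ofReal (∫ y in ball x R ∩ unitCube n, |f y| ^ (2:ℝ)) := by
    rw [ofReal_integral_eq_lintegral_ofReal (integrableOn_pow n f hf 2 (by norm_num) x R)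
      (Filter.Eventually.of_forall fun y => by positivity)]
    apply lintegral_congr
    intro y
    rw [Real.rpow_two, ENNReal.ofReal_pow (abs_nonneg _), Real.enorm_eq_ofReal_abs]
  rw [heq]
  apply ENNReal.ofReal_le_ofReal
  set I := ∫ y in ball x R ∩ unitCube n, |f y| ^ (2:ℝ)
  set N := morreyNorm n p 2 (unitCube n) f
  have hsq : (R ^ ((n : ℝ) * (1/p - 1/2)) * I ^ (1/2:ℝ)) ^ 2 ≤ N ^ 2 := by
    gcongr
  have e1 : (R ^ ((n : ℝ) * (1/p - 1/2)) * I ^ (1/2:ℝ)) ^ 2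
      = R ^ (2 * (n/p) - (n:ℝ)) * I := by
    rw [mul_pow, ← Real.rpow_natCast, ← Real.rpow_natCast, ← Real.rpow_mul h0.le,
      ← Real.rpow_mul hI]
    norm_num
    left
    congr 1
    field_simp
  rw [e1] at hsq
  calc I = R ^ ((n:ℝ) - 2 * (n / p)) * (R ^ (2 * (n/p) - (n:ℝ)) * I) := by
        rw [← mul_assoc, ← Real.rpow_add h0]; simp
    _ ≤ _ := by gcongr

/-- The abstract Morrey condition with decay exponent. -/
def MCond (n : ℕ) (a D : ℝ) (f : EE n → ℝ) : Prop :=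
  ∀ (x : EE n) (R : ℝ), 0 < R → R ≤ 1 →
      ∫⁻ y in ball x R ∩ unitCube n, ‖f y‖ₑ ^ 2 ≤ ENNReal.ofReal (R ^ ((n:ℝ) - 2 * a) * D ^ 2)

lemma avg1 (n : ℕ) (hn : 4 ≤ n) (a D : ℝ) (hD : 0 ≤ D) (f : EE n → ℝ) (hf : Continuous f)
    (hM : MCond n a D f) (x : EE n) (hx : x ∈ unitCube n) (s : ℝ) (h0 : 0 < s)
    (hs : s ≤ 1 / (2 * √n)) :
    ∫⁻ y in unitCube n, ‖f (x + s • (y - x))‖ₑ ≤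
      ENNReal.ofReal (s ^ (-a) * (√((2 * √n) ^ ((n:ℝ) - 2 * a)) * D)) := by
  have hsn : (2:ℝ) ≤ √n := by
    rw [show (2:ℝ) = √4 by rw [show (4:ℝ) = 2^2 by norm_num]; simp]
    exact Real.sqrt_le_sqrt (by exact_mod_cast hn)
  rw [le_div_iff₀ (by positivity)] at hs
  have hs1 : s ≤ 1 := by nlinarith
  have h1 := sq_lintegral_le (volume.restrict (unitCube n)) (fun y => ‖f (x + s • (y - x))‖ₑ)
    (Continuous.measurable (by fun_prop))
  rw [Measure.restrict_apply_univ, volume_unitCube, one_mul] at h1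
  have h2 := cov_y n hn (fun y => ‖f y‖ₑ ^ 2) (by fun_prop) x s hx h0 hs1
  have h3 := hM x (2 * √n * s) (by positivity) (by linarith)
  rw [← ENNReal.pow_le_pow_left_iff (n := 2) (by norm_num)]
  refine (h1.trans h2).trans ?_
  refine (mul_le_mul_right h3 _).trans ?_
  rw [← ENNReal.ofReal_mul (by positivity), ← ENNReal.ofReal_pow (by positivity)]
  apply ENNReal.ofReal_le_ofReal
  apply le_of_eq
  rw [mul_pow, mul_pow, Real.sq_sqrt (by positivity), Real.mul_rpow (by positivity) h0.le,
    ← Real.rpow_natCast, ← Real.rpow_natCast (s ^ (-a)), ← Real.rpow_neg h0.le, ← Real.rpow_mul h0.le]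
  have : s ^ (-a * (2:ℕ)) = s ^ (-(n:ℝ)) * s ^ ((n:ℝ) - 2 * a) := by
    rw [← Real.rpow_add h0]; congr 1; push_cast; ring
  rw [this]; ring

lemma avg2 (n : ℕ) (hn : 4 ≤ n) (a : ℝ) (ha : 1 < a) : ∃ C : ℝ, 0 < C ∧
    ∀ (D : ℝ) (_ : 0 ≤ D) (u : EE n → ℝ) (_ : ContDiff ℝ 1 u)
    (_ : MCond n a D u) (_ : MCond n a D (fun y => ‖fderiv ℝ u y‖))
    (x : EE n) (_ : x ∈ unitCube n) (t : ℝ) (_ : 0 < t) (_ : t ≤ 1 / (2 * √n)),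
    ∫⁻ y in unitCube n, ‖u (x + t • (y - x))‖ₑ ≤ ENNReal.ofReal (C * t ^ (-(a - 1)) * D) := by
  have hsn : (2:ℝ) ≤ √n := by
    rw [show (2:ℝ) = √4 by rw [show (4:ℝ) = 2^2 by norm_num]; simp]
    exact Real.sqrt_le_sqrt (by exact_mod_cast hn)
  set σ : ℝ := 1 / (2 * √n) with hσ
  have hσ0 : 0 < σ := by positivity
  have hσ1 : σ ≤ 1 := by rw [hσ, div_le_one (by positivity)]; linarith
  set c := √((2 * √n) ^ ((n:ℝ) - 2 * a)) with hc
  have hc0 : 0 < c := by positivity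
  have ha1 : 0 < a - 1 := by linarith
  refine ⟨σ ^ (-a) * c + √n * c / (a - 1), by positivity, ?_⟩
  intro D hD u hu hMu hMw x hx t ht0 htσ
  have hwc : Continuous (fun y => ‖fderiv ℝ u y‖) := (hu.continuous_fderiv (by simp)).norm
  have hpt : ∀ y ∈ unitCube n, ‖u (x + t • (y - x))‖ₑ ≤ ‖u (x + σ • (y - x))‖ₑ +
      ENNReal.ofReal (√n) * ∫⁻ s in Set.Icc t σ, ‖fderiv ℝ u (x + s • (y - x))‖ₑ := by
    intro y hy
    have h1 := ftc_le n u hu x (y - x) t σ htσ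
    have h2 : ‖u (x + t • (y - x))‖ₑ ≤ ‖u (x + σ • (y - x))‖ₑ +
        ‖u (x + σ • (y - x)) - u (x + t • (y - x))‖ₑ := by
      have := enorm_sub_le (a := u (x + σ • (y - x)))
        (b := u (x + σ • (y - x)) - u (x + t • (y - x)))
      simpa using this
    refine h2.trans (add_le_add le_rfl (h1.trans ?_))
    rw [lintegral_mul_const', mul_comm]
    · gcongr
      rw [← ofReal_norm]
      exact ENNReal.ofReal_le_ofReal (norm_sub_unitCube n hx hy)
    · exact enorm_ne_top
  have hmeas : Measurable (fun z : EE n × ℝ => ‖fderiv ℝ u (x + z.2 • (z.1 - x))‖ₑ) := by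
    have : Continuous (fderiv ℝ u) := hu.continuous_fderiv (by simp)
    have h2 : Continuous (fun z : EE n × ℝ => ‖fderiv ℝ u (x + z.2 • (z.1 - x))‖ₑ) := by fun_prop
    exact h2.measurable
  have hrp : ∫⁻ s in Set.Icc t σ, ENNReal.ofReal (s ^ (-a) * (c * D)) ≤
      ENNReal.ofReal (t ^ (-(a-1)) / (a - 1) * (c * D)) := by
    have h0 : (0:ℝ) ∉ Set.uIcc t σ := by
      rw [Set.uIcc_of_le htσ]; intro h; linarith [h.1]
    have hi : IntegrableOn (fun s : ℝ => s ^ (-a) * (c * D)) (Set.Icc t σ) := by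
      apply ContinuousOn.integrableOn_Icc
      apply ContinuousOn.mul _ continuousOn_const
      intro s hs
      exact (Real.continuousAt_rpow_const s _ (Or.inl (by linarith [hs.1]))).continuousWithinAt
    rw [← ofReal_integral_eq_lintegral_ofReal hi]
    · apply ENNReal.ofReal_le_ofReal
      rw [integral_Icc_eq_integral_Ioc, ← intervalIntegral.integral_of_le htσ,
        intervalIntegral.integral_mul_const]
      gcongr
      rw [integral_rpow (Or.inr ⟨by linarith, h0⟩)]
      rw [show -a + 1 = -(a-1) by ring, div_neg, ← neg_div]
      gcongr
      have : 0 ≤ σ ^ (-(a-1)) := by positivity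
      linarith
    · filter_upwards [ae_restrict_mem measurableSet_Icc] with s hs
      have : 0 < s := by linarith [hs.1]
      simp only [Pi.zero_apply]
      positivity
  calc ∫⁻ y in unitCube n, ‖u (x + t • (y - x))‖ₑ
      ≤ ∫⁻ y in unitCube n, (‖u (x + σ • (y - x))‖ₑ +
        ENNReal.ofReal (√n) * ∫⁻ s in Set.Icc t σ, ‖fderiv ℝ u (x + s • (y - x))‖ₑ) :=
        setLIntegral_mono' (measurableSet_unitCube n) hpt
    _ = (∫⁻ y in unitCube n, ‖u (x + σ • (y - x))‖ₑ) + ENNReal.ofReal (√n) *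
        ∫⁻ s in Set.Icc t σ, ∫⁻ y in unitCube n, ‖fderiv ℝ u (x + s • (y - x))‖ₑ := by
        have hcu := hu.continuous
        rw [lintegral_add_left (Continuous.measurable (by fun_prop)), lintegral_const_mul' _ _ ENNReal.ofReal_ne_top,
          lintegral_lintegral_swap hmeas.aemeasurable]
    _ ≤ ENNReal.ofReal (σ ^ (-a) * (c * D)) + ENNReal.ofReal (√n) *
        ∫⁻ s in Set.Icc t σ, ENNReal.ofReal (s ^ (-a) * (c * D)) := by
        gcongr ?_ + _ * ?_
        · exact avg1 n hn a D hD u hu.continuous hMu x hx σ hσ0 le_rfl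
        · apply setLIntegral_mono' measurableSet_Icc
          intro s hs
          have := avg1 n hn a D hD _ hwc hMw x hx s (by linarith [hs.1]) hs.2
          simpa only [enorm_norm] using this
    _ ≤ ENNReal.ofReal (σ ^ (-a) * (c * D)) + ENNReal.ofReal (√n) *
        ENNReal.ofReal (t ^ (-(a-1)) / (a - 1) * (c * D)) := by gcongr
    _ = ENNReal.ofReal (σ ^ (-a) * (c * D) + √n * (t ^ (-(a-1)) / (a - 1) * (c * D))) := by
        rw [← ENNReal.ofReal_mul (by positivity), ← ENNReal.ofReal_add (by positivity)
          (by positivity)]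
    _ ≤ _ := by
        apply ENNReal.ofReal_le_ofReal
        have h1 : 1 ≤ t ^ (-(a-1)) :=
          Real.one_le_rpow_of_pos_of_le_one_of_nonpos ht0 (htσ.trans hσ1) (by linarith)
        have h2 : σ ^ (-a) * (c * D) * 1 ≤ σ ^ (-a) * (c * D) * t ^ (-(a-1)) := by gcongr
        have h3 : √n * (t ^ (-(a-1)) / (a - 1) * (c * D)) =
          √n * c / (a - 1) * t ^ (-(a-1)) * D := by ring
        rw [h3]; nlinarith

lemma exists_theta : ∃ (θ : ℝ → ℝ) (K : ℝ), 0 < K ∧ ContDiff ℝ 1 θ ∧ (∀ s, 0 ≤ θ s) ∧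
    (∀ s, θ s ≤ |s|) ∧ (∀ s, 2 ≤ |s| → θ s = 1) ∧ (∀ s, |deriv θ s| ≤ K) ∧
    (∀ s, ¬ (1 ≤ |s| ∧ |s| < 2) → deriv θ s = 0) := by
  set θ : ℝ → ℝ := fun s => Real.smoothTransition ((s ^ 2 - 1) / 3) with hθ
  have hC : ContDiff ℝ 1 θ := by
    have h : ContDiff ℝ 1 Real.smoothTransition := Real.smoothTransition.contDiff (n := 1)
    exact h.comp (by fun_prop)
  have h0 : ∀ s, 0 ≤ θ s := fun s => Real.smoothTransition.nonneg _
  have h1 : ∀ s, θ s ≤ 1 := fun s => Real.smoothTransition.le_one _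
  have hz : ∀ s, |s| ≤ 1 → θ s = 0 := by
    intro s hs
    apply Real.smoothTransition.zero_of_nonpos
    have := sq_abs s
    have := abs_nonneg s
    nlinarith
  have ho : ∀ s, 2 ≤ |s| → θ s = 1 := by
    intro s hs
    apply Real.smoothTransition.one_of_one_le
    have := sq_abs s
    nlinarith
  have hd : ∀ s, ¬ (1 ≤ |s| ∧ |s| < 2) → deriv θ s = 0 := by
    intro s hs
    by_cases h : |s| ≤ 1
    · apply IsLocalMin.deriv_eq_zero
      apply Filter.Eventually.of_forall
      intro y
      rw [hz s h]; exact h0 y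
    · apply IsLocalMax.deriv_eq_zero
      apply Filter.Eventually.of_forall
      intro y
      rw [ho s (by by_contra h2; exact hs ⟨by linarith, by linarith⟩)]; exact h1 y
  have hdc : Continuous (deriv θ) := hC.continuous_deriv (by simp)
  obtain ⟨K, hK⟩ := (isCompact_Icc (a := (-2:ℝ)) (b := 2)).exists_bound_of_continuousOn
    hdc.continuousOn
  refine ⟨θ, max K 1, by positivity, hC, h0, ?_, ho, ?_, hd⟩
  · intro s
    by_cases h : |s| ≤ 1
    · rw [hz s h]; exact abs_nonneg s
    · linarith [h1 s]
  · intro s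
    by_cases h : |s| ≤ 2
    · exact (hK s (abs_le.1 h)).trans (le_max_left _ _)
    · rw [hd s (by intro h2; linarith [h2.2])]
      simp

/-- The level estimate. -/
lemma level (n : ℕ) (hn : 4 ≤ n) : ∃ K : ℝ, 0 < K ∧
    ∀ (u : EE n → ℝ) (_ : ContDiff ℝ 1 u) (x₀ : EE n) (r : ℝ) (_ : 0 < r) (_ : r ≤ 1)
    (l : ℝ) (_ : 0 < l) (t : ℝ) (_ : 0 < t) (_ : t ≤ r / (2 * √n))
    (_ : ∀ x ∈ unitCube n, ∫⁻ y in unitCube n, ‖u (x + t • (y - x))‖ₑ ≤ ENNReal.ofReal (l / 2)),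
    ENNReal.ofReal (l ^ 2) * volume ((ball x₀ r ∩ unitCube n) ∩ {x | 2 * l ≤ |u x|}) ≤
      ENNReal.ofReal (K * t ^ 2) *
        ∫⁻ x in (ball x₀ (2 * r) ∩ unitCube n) ∩ {x | l ≤ |u x| ∧ |u x| < 2 * l},
          ‖fderiv ℝ u x‖ₑ ^ 2 := by
  obtain ⟨θ, K, hK, hθC, hθ0, hθle, hθ1, hθK, hθd⟩ := exists_theta
  have hsn : (2:ℝ) ≤ √n := by
    rw [show (2:ℝ) = √4 by rw [show (4:ℝ) = 2^2 by norm_num]; simp]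
    exact Real.sqrt_le_sqrt (by exact_mod_cast hn)
  refine ⟨4 * (K * √n) ^ 2 * 2 ^ n, by positivity, ?_⟩
  intro u hu x₀ r hr0 hr1 l hl t ht0 ht hav
  have ht1 : t ≤ 1 := by
    rw [le_div_iff₀ (by positivity)] at ht
    nlinarith
  have huc := hu.continuous
  have hfc : Continuous (fderiv ℝ u) := hu.continuous_fderiv (by simp)
  set L : Set (EE n) := {x | l ≤ |u x| ∧ |u x| < 2 * l} with hL
  have hLm : MeasurableSet L := by
    apply MeasurableSet.inter
    · exact measurableSet_le measurable_const huc.abs.measurable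
    · exact measurableSet_lt huc.abs.measurable measurable_const
  set h : EE n → ENNReal := L.indicator (fun x => ‖fderiv ℝ u x‖ₑ) with hh
  have hhm : Measurable h := (Continuous.measurable (by fun_prop)).indicator hLm
  set g : EE n → ℝ := fun x => l * θ (u x / l) with hg
  have hgC : ContDiff ℝ 1 g := contDiff_const.mul (hθC.comp (hu.div_const l))
  have hgd : ∀ x, ‖fderiv ℝ g x‖ₑ ≤ ENNReal.ofReal K * h x := by
    intro x
    have hD : HasFDerivAt g (deriv θ (u x / l) • fderiv ℝ u x) x := by
      have h1 : HasFDerivAt u (fderiv ℝ u x) x := (hu.differentiable (by simp) x).hasFDerivAt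
      have h2 : HasDerivAt (fun z : ℝ => l * θ (z / l)) (deriv θ (u x / l)) (u x) := by
        have h3 : HasDerivAt θ (deriv θ (u x / l)) (u x / l) :=
          (hθC.differentiable (by simp) _).hasDerivAt
        have h4 := (h3.comp (u x) ((hasDerivAt_id (u x)).div_const l)).const_mul l
        have e : ∀ d : ℝ, l * (d * (1 / l)) = d := fun d => by field_simp
        rw [e] at h4
        exact h4
      exact h2.comp_hasFDerivAt x h1
    rw [hD.fderiv]
    by_cases hx : x ∈ L
    · rw [hh, Set.indicator_of_mem hx, enorm_smul, Real.enorm_eq_ofReal_abs]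
      gcongr
      exact hθK _
    · have : deriv θ (u x / l) = 0 := by
        apply hθd
        intro h2
        apply hx
        rw [abs_div, abs_of_pos hl, le_div_iff₀ hl, div_lt_iff₀ hl, one_mul] at h2
        exact h2
      rw [this, enorm_smul, enorm_zero, zero_mul]
      exact zero_le
  have hgu : ∀ x, ‖g x‖ₑ ≤ ‖u x‖ₑ := by
    intro x
    rw [Real.enorm_eq_ofReal_abs, Real.enorm_eq_ofReal_abs]
    apply ENNReal.ofReal_le_ofReal
    have h1 := hθle (u x / l)
    rw [abs_div, abs_of_pos hl, le_div_iff₀ hl] at h1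
    rw [hg, abs_of_nonneg (mul_nonneg hl.le (hθ0 _))]
    linarith
  have hm3 : Measurable (fun z : (EE n × EE n) × ℝ => h (z.1.1 + z.2 • (z.1.2 - z.1.1))) :=
    hhm.comp (Continuous.measurable (by fun_prop))
  have hm2 : Measurable (fun z : EE n × EE n =>
      ∫⁻ s in Set.Icc 0 t, h (z.1 + s • (z.2 - z.1)) ^ 2) :=
    (hm3.pow_const 2).lintegral_prod_right'
  have hm2' : Measurable (fun z : EE n × EE n =>
      ∫⁻ s in Set.Icc 0 t, h (z.1 + s • (z.2 - z.1))) :=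
    hm3.lintegral_prod_right'
  -- pointwise estimate
  have hpt : ∀ x ∈ (ball x₀ r ∩ unitCube n) ∩ {x | 2 * l ≤ |u x|},
      ENNReal.ofReal (l ^ 2) ≤ ENNReal.ofReal (4 * (K * √n) ^ 2 * t) *
        ∫⁻ y in unitCube n, ∫⁻ s in Set.Icc 0 t, h (x + s • (y - x)) ^ 2 := by
    rintro x ⟨⟨_, hx⟩, hxu⟩
    have hgx : g x = l := by
      rw [hg]
      simp only
      rw [hθ1, mul_one]
      rw [abs_div, abs_of_pos hl, le_div_iff₀ hl]
      exact hxu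
    have hsx : Measurable (fun z : EE n × ℝ => h (x + z.2 • (z.1 - x))) :=
      hhm.comp (Continuous.measurable (by fun_prop))
    have hy : ∀ y ∈ unitCube n, ENNReal.ofReal l ≤ ‖u (x + t • (y - x))‖ₑ +
        ENNReal.ofReal (K * √n) * ∫⁻ s in Set.Icc 0 t, h (x + s • (y - x)) := by
      intro y hy
      have h1 := ftc_le n g hgC x (y - x) 0 t ht0.le
      simp only [zero_smul, add_zero, hgx] at h1
      have h2 : ENNReal.ofReal l ≤ ‖g (x + t • (y - x))‖ₑ + ‖g (x + t • (y - x)) - l‖ₑ := by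
        have := enorm_sub_le (a := g (x + t • (y - x))) (b := g (x + t • (y - x)) - l)
        rw [sub_sub_cancel, Real.enorm_eq_ofReal_abs l, abs_of_pos hl] at this
        exact this
      refine h2.trans (add_le_add (hgu _) (h1.trans ?_))
      rw [← lintegral_const_mul' _ _ ENNReal.ofReal_ne_top]
      apply lintegral_mono
      intro s
      simp only
      rw [ENNReal.ofReal_mul hK.le, mul_right_comm]
      refine mul_le_mul' (hgd _) ?_
      rw [← ofReal_norm]
      exact ENNReal.ofReal_le_ofReal (norm_sub_unitCube n hx hy)
    have hsec : Measurable (fun y => ∫⁻ s in Set.Icc 0 t, h (x + s • (y - x))) :=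
      hm2'.comp (measurable_const.prodMk measurable_id)
    have h3 : ENNReal.ofReal l ≤ ENNReal.ofReal (l / 2) + ENNReal.ofReal (K * √n) *
        ∫⁻ y in unitCube n, ∫⁻ s in Set.Icc 0 t, h (x + s • (y - x)) := by
      calc ENNReal.ofReal l = ∫⁻ y in unitCube n, ENNReal.ofReal l := by
            rw [setLIntegral_const, volume_unitCube, mul_one]
        _ ≤ ∫⁻ y in unitCube n, (‖u (x + t • (y - x))‖ₑ +
            ENNReal.ofReal (K * √n) * ∫⁻ s in Set.Icc 0 t, h (x + s • (y - x))) :=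
            setLIntegral_mono' (measurableSet_unitCube n) hy
        _ = (∫⁻ y in unitCube n, ‖u (x + t • (y - x))‖ₑ) + ENNReal.ofReal (K * √n) *
            ∫⁻ y in unitCube n, ∫⁻ s in Set.Icc 0 t, h (x + s • (y - x)) := by
            rw [lintegral_add_left (Continuous.measurable (by fun_prop)),
              lintegral_const_mul' _ _ ENNReal.ofReal_ne_top]
        _ ≤ _ := by gcongr; exact hav x hx
    have h4 : ENNReal.ofReal (l / 2) ≤ ENNReal.ofReal (K * √n) *
        ∫⁻ y in unitCube n, ∫⁻ s in Set.Icc 0 t, h (x + s • (y - x)) := by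
      rw [show l = l / 2 + l / 2 by ring, ENNReal.ofReal_add (by positivity) (by positivity)] at h3
      rw [show (l / 2 + l / 2) / 2 = l / 2 by ring] at h3
      exact (ENNReal.add_le_add_iff_left ENNReal.ofReal_ne_top).1 h3
    have h5 : (∫⁻ y in unitCube n, ∫⁻ s in Set.Icc 0 t, h (x + s • (y - x))) ^ 2 ≤
        ENNReal.ofReal t * ∫⁻ y in unitCube n, ∫⁻ s in Set.Icc 0 t, h (x + s • (y - x)) ^ 2 := by
      refine (sq_lintegral_le _ _ hsec).trans ?_
      rw [Measure.restrict_apply_univ, volume_unitCube, one_mul,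
        ← lintegral_const_mul' _ _ ENNReal.ofReal_ne_top]
      apply lintegral_mono
      intro y
      refine (sq_lintegral_le _ _ (hhm.comp (Continuous.measurable (by fun_prop)))).trans ?_
      rw [Measure.restrict_apply_univ, Real.volume_Icc, sub_zero]
      exact le_rfl
    calc ENNReal.ofReal (l ^ 2) = ENNReal.ofReal 4 * (ENNReal.ofReal (l / 2)) ^ 2 := by
          rw [← ENNReal.ofReal_pow (by positivity), ← ENNReal.ofReal_mul (by positivity)]
          congr 1; ring
      _ ≤ ENNReal.ofReal 4 * (ENNReal.ofReal (K * √n) *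
          ∫⁻ y in unitCube n, ∫⁻ s in Set.Icc 0 t, h (x + s • (y - x))) ^ 2 := by gcongr
      _ ≤ ENNReal.ofReal 4 * (ENNReal.ofReal ((K * √n) ^ 2) * (ENNReal.ofReal t *
          ∫⁻ y in unitCube n, ∫⁻ s in Set.Icc 0 t, h (x + s • (y - x)) ^ 2)) := by
          rw [mul_pow, ← ENNReal.ofReal_pow (by positivity)]
          gcongr
      _ = _ := by
          rw [ENNReal.ofReal_mul (by positivity), ENNReal.ofReal_mul (by positivity)]
          ring
  set S := (ball x₀ r ∩ unitCube n) ∩ {x | 2 * l ≤ |u x|} with hS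
  have hBm : MeasurableSet (ball x₀ r ∩ unitCube n) :=
    measurableSet_ball.inter (measurableSet_unitCube n)
  have hSm : MeasurableSet S :=
    hBm.inter (measurableSet_le measurable_const huc.abs.measurable)
  have hswap : ∫⁻ x in ball x₀ r ∩ unitCube n, ∫⁻ y in unitCube n, ∫⁻ s in Set.Icc 0 t,
      h (x + s • (y - x)) ^ 2 = ∫⁻ y in unitCube n, ∫⁻ s in Set.Icc 0 t,
      ∫⁻ x in ball x₀ r ∩ unitCube n, h (x + s • (y - x)) ^ 2 := by
    rw [lintegral_lintegral_swap hm2.aemeasurable]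
    apply lintegral_congr
    intro y
    rw [lintegral_lintegral_swap]
    apply Measurable.aemeasurable
    exact (hhm.comp (g := h) (f := fun z : EE n × ℝ => z.1 + z.2 • (y - z.1))
      (Continuous.measurable (by fun_prop))).pow_const 2
  calc ENNReal.ofReal (l ^ 2) * volume S = ∫⁻ x in S, ENNReal.ofReal (l ^ 2) := by
        rw [setLIntegral_const]
    _ ≤ ∫⁻ x in S, ENNReal.ofReal (4 * (K * √n) ^ 2 * t) *
        ∫⁻ y in unitCube n, ∫⁻ s in Set.Icc 0 t, h (x + s • (y - x)) ^ 2 :=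
        setLIntegral_mono' hSm hpt
    _ ≤ ∫⁻ x in ball x₀ r ∩ unitCube n, ENNReal.ofReal (4 * (K * √n) ^ 2 * t) *
        ∫⁻ y in unitCube n, ∫⁻ s in Set.Icc 0 t, h (x + s • (y - x)) ^ 2 :=
        lintegral_mono_set Set.inter_subset_left
    _ = ENNReal.ofReal (4 * (K * √n) ^ 2 * t) * ∫⁻ y in unitCube n, ∫⁻ s in Set.Icc 0 t,
      ∫⁻ x in ball x₀ r ∩ unitCube n, h (x + s • (y - x)) ^ 2 := by
        rw [lintegral_const_mul' _ _ ENNReal.ofReal_ne_top, hswap]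
    _ ≤ ENNReal.ofReal (4 * (K * √n) ^ 2 * t) * ∫⁻ y in unitCube n, ∫⁻ s in Set.Icc 0 t,
        (2 ^ n * ∫⁻ x in ball x₀ (2 * r) ∩ unitCube n, h x ^ 2) := by
        refine mul_le_mul_right ?_ _
        apply setLIntegral_mono' (measurableSet_unitCube n)
        intro y hy
        apply setLIntegral_mono' measurableSet_Icc
        intro s hs
        exact cov_x n hn (fun x => h x ^ 2) (hhm.pow_const 2) x₀ y r s hr1 hy hs.1 (hs.2.trans ht)
    _ = ENNReal.ofReal (4 * (K * √n) ^ 2 * 2 ^ n * t ^ 2) *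
        ∫⁻ x in ball x₀ (2 * r) ∩ unitCube n, h x ^ 2 := by
        rw [setLIntegral_const, setLIntegral_const, volume_unitCube, Real.volume_Icc, sub_zero,
          mul_one, show 4 * (K * √n) ^ 2 * 2 ^ n * t ^ 2 = (4 * (K * √n) ^ 2 * t) * (2 ^ n * t)
            by ring, ENNReal.ofReal_mul (p := 4 * (K * √n) ^ 2 * t) (by positivity),
          ENNReal.ofReal_mul (p := 2 ^ n) (by positivity), ENNReal.ofReal_pow (by norm_num) n]
        simp only [ENNReal.ofReal_ofNat]
        ring
    _ = _ := by
        congr 1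
        rw [Set.inter_comm _ L, ← Measure.restrict_restrict hLm, ← lintegral_indicator hLm]
        apply lintegral_congr
        intro x
        by_cases hx : x ∈ L
        · simp [hh, hx]
        · simp [hh, hx]

lemma layer (n : ℕ) (u : EE n → ℝ) (huc : Continuous u) (B B' : Set (EE n))
    (hB : MeasurableSet B) (hB' : MeasurableSet B') (w : EE n → ENNReal)
    (l₀ : ℝ) (hl₀ : 0 < l₀) (Q : ENNReal)
    (H : ∀ l, l₀ ≤ l → ENNReal.ofReal (l ^ 4) * volume (B ∩ {x | 2 * l ≤ |u x|}) ≤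
      Q * ∫⁻ x in B' ∩ {x | l ≤ |u x| ∧ |u x| < 2 * l}, w x) (J : ℕ) :
    ∫⁻ x in B, ENNReal.ofReal (min |u x| (2 * (2 ^ J * l₀)) ^ 4) ≤
      ENNReal.ofReal ((2 * l₀) ^ 4) * volume B +
        256 * Q * ∫⁻ x in B' ∩ {x | |u x| < 2 ^ J * l₀}, w x := by
  induction J with
  | zero =>
    refine le_trans ?_ le_self_add
    rw [← setLIntegral_const]
    apply lintegral_mono
    intro x
    apply ENNReal.ofReal_le_ofReal
    have : 0 ≤ min |u x| (2 * (2 ^ 0 * l₀)) := by positivity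
    gcongr
    simp
  | succ J ih =>
    set l := 2 ^ J * l₀ with hl
    have hll : l₀ ≤ l := by
      have : (1:ℝ) ≤ 2 ^ J := one_le_pow₀ (by norm_num)
      nlinarith
    have hl0 : 0 < l := by linarith
    have e : 2 ^ (J + 1) * l₀ = 2 * l := by rw [hl]; ring
    rw [e]
    set T := {x | 2 * l ≤ |u x|} with hT
    have hTm : MeasurableSet T := measurableSet_le measurable_const huc.abs.measurable
    have hpt : ∀ x, ENNReal.ofReal (min |u x| (2 * (2 * l)) ^ 4) ≤
        ENNReal.ofReal (min |u x| (2 * l) ^ 4) +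
          T.indicator (fun _ => ENNReal.ofReal (256 * l ^ 4)) x := by
      intro x
      by_cases hx : x ∈ T
      · rw [Set.indicator_of_mem hx]
        refine le_trans ?_ le_add_self
        apply ENNReal.ofReal_le_ofReal
        have : 0 ≤ min |u x| (2 * (2 * l)) := by positivity
        calc min |u x| (2 * (2 * l)) ^ 4 ≤ (2 * (2 * l)) ^ 4 := by
              gcongr; exact min_le_right _ _
          _ = 256 * l ^ 4 := by ring
      · rw [Set.indicator_of_notMem hx, add_zero]
        have hx' : |u x| < 2 * l := not_le.1 hx
        rw [min_eq_left (by linarith), min_eq_left hx'.le]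
    have hsplit : ∫⁻ x in B' ∩ {x | |u x| < 2 * l}, w x =
        (∫⁻ x in B' ∩ {x | |u x| < l}, w x) +
          ∫⁻ x in B' ∩ {x | l ≤ |u x| ∧ |u x| < 2 * l}, w x := by
      rw [← lintegral_union]
      · congr 2
        ext x
        simp only [Set.mem_inter_iff, Set.mem_ofPred_eq, Set.mem_union]
        constructor
        · rintro ⟨h1, h2⟩
          by_cases h : |u x| < l
          · exact Or.inl ⟨h1, h⟩
          · exact Or.inr ⟨h1, not_lt.1 h, h2⟩
        · rintro (⟨h1, h2⟩ | ⟨h1, h2, h3⟩)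
          · exact ⟨h1, by linarith⟩
          · exact ⟨h1, h3⟩
      · apply hB'.inter
        apply MeasurableSet.inter
        · exact measurableSet_le measurable_const huc.abs.measurable
        · exact measurableSet_lt huc.abs.measurable measurable_const
      · rw [Set.disjoint_left]
        rintro x ⟨_, h1⟩ ⟨_, h2, _⟩
        simp only [Set.mem_ofPred_eq] at h1
        linarith
    calc ∫⁻ x in B, ENNReal.ofReal (min |u x| (2 * (2 * l)) ^ 4)
        ≤ ∫⁻ x in B, (ENNReal.ofReal (min |u x| (2 * l) ^ 4) +
          T.indicator (fun _ => ENNReal.ofReal (256 * l ^ 4)) x) := lintegral_mono hpt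
      _ = (∫⁻ x in B, ENNReal.ofReal (min |u x| (2 * l) ^ 4)) +
          256 * (ENNReal.ofReal (l ^ 4) * volume (B ∩ T)) := by
          have hmm : Measurable (fun x => ENNReal.ofReal (min |u x| (2 * l) ^ 4)) :=
            ENNReal.measurable_ofReal.comp (Continuous.measurable (by fun_prop))
          rw [lintegral_add_left hmm,
            lintegral_indicator_const hTm, Measure.restrict_apply hTm, Set.inter_comm,
            ENNReal.ofReal_mul (by norm_num), ENNReal.ofReal_ofNat, mul_assoc]
      _ ≤ (ENNReal.ofReal ((2 * l₀) ^ 4) * volume B +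
          256 * Q * ∫⁻ x in B' ∩ {x | |u x| < l}, w x) +
          256 * (Q * ∫⁻ x in B' ∩ {x | l ≤ |u x| ∧ |u x| < 2 * l}, w x) := by
          exact add_le_add ih (mul_le_mul_right (H l hll) _)
      _ = _ := by rw [hsplit]; ring

lemma grad_ball (n : ℕ) (a : ℝ) (ha : 2 * a ≤ n) : ∃ N : ℝ, 0 < N ∧
    ∀ (D : ℝ) (f : EE n → ℝ) (_ : MCond n a D f) (x₀ : EE n) (r : ℝ) (_ : 0 < r),
    ∫⁻ y in ball x₀ (2 * r) ∩ unitCube n, ‖f y‖ₑ ^ 2 ≤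
      ENNReal.ofReal (N * r ^ ((n:ℝ) - 2 * a) * D ^ 2) := by
  obtain ⟨T, -, hTf, hT⟩ := finite_cover_balls_of_compact (isCompact_unitCube n) (e := 1) one_pos
  lift T to Finset (EE n) using hTf
  refine ⟨(T.card + 1) * 2 ^ ((n:ℝ) - 2 * a), by positivity, ?_⟩
  intro D f hM x₀ r hr
  rw [mul_assoc ((T.card : ℝ) + 1), ← Real.mul_rpow (by norm_num) hr.le]
  by_cases h2 : 2 * r ≤ 1
  · refine (hM x₀ (2 * r) (by positivity) h2).trans ?_
    apply ENNReal.ofReal_le_ofReal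
    gcongr
    have : 0 ≤ (T.card : ℝ) * (2 * r) ^ ((n:ℝ) - 2 * a) := by positivity
    linarith
  · have hone : 1 ≤ (2 * r) ^ ((n:ℝ) - 2 * a) :=
      Real.one_le_rpow (by linarith) (by linarith)
    calc ∫⁻ y in ball x₀ (2 * r) ∩ unitCube n, ‖f y‖ₑ ^ 2
        ≤ ∫⁻ y in ⋃ x ∈ T, (ball x 1 ∩ unitCube n), ‖f y‖ₑ ^ 2 := by
          apply lintegral_mono_set
          rintro y ⟨_, hy⟩
          have := hT hy
          simp only [Set.mem_iUnion] at this ⊢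
          obtain ⟨x, hx, hxy⟩ := this
          exact ⟨x, hx, hxy, hy⟩
      _ ≤ ∑ x ∈ T, ∫⁻ y in ball x 1 ∩ unitCube n, ‖f y‖ₑ ^ 2 := by
          have hE : (⋃ x ∈ T, (ball x 1 ∩ unitCube n)) =
              ⋃ x : T, (ball (x : EE n) 1 ∩ unitCube n) := by
            ext y; simp; tauto
          rw [hE]
          refine (lintegral_iUnion_le _ _).trans ?_
          rw [tsum_fintype, Finset.sum_coe_sort T
            (fun x => ∫⁻ y in ball x 1 ∩ unitCube n, ‖f y‖ₑ ^ 2)]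
      _ ≤ ∑ x ∈ T, ENNReal.ofReal (D ^ 2) := by
          apply Finset.sum_le_sum
          intro x _
          have := hM x 1 one_pos le_rfl
          simpa using this
      _ = ENNReal.ofReal (T.card * D ^ 2) := by
          rw [Finset.sum_const, nsmul_eq_mul, ENNReal.ofReal_mul (by positivity)]
          simp
      _ ≤ _ := by
          apply ENNReal.ofReal_le_ofReal
          gcongr
          have : (T.card : ℝ) * 1 ≤ T.card * (2 * r) ^ ((n:ℝ) - 2 * a) := by gcongr
          linarith

lemma core (n : ℕ) (hn : 4 ≤ n) (a : ℝ) (ha1 : 1 < a) (ha2 : a ≤ 2) : ∃ C : ℝ, 0 < C ∧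
    ∀ (D : ℝ) (_ : 0 < D) (u : EE n → ℝ) (_ : ContDiff ℝ 1 u)
    (_ : MCond n a D u) (_ : MCond n a D (fun y => ‖fderiv ℝ u y‖))
    (x₀ : EE n) (r : ℝ) (_ : 0 < r) (_ : r ≤ 1),
    ∫⁻ x in ball x₀ r ∩ unitCube n, ENNReal.ofReal (|u x| ^ 4) ≤
      ENNReal.ofReal (C * D ^ 4 * r ^ ((n:ℝ) - 4 * (a - 1))) := by
  have hsn : (2:ℝ) ≤ √n := by
    rw [show (2:ℝ) = √4 by rw [show (4:ℝ) = 2^2 by norm_num]; simp]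
    exact Real.sqrt_le_sqrt (by exact_mod_cast hn)
  have hn4 : (4:ℝ) ≤ n := by exact_mod_cast hn
  obtain ⟨C1, hC1, hav⟩ := avg2 n hn a ha1
  obtain ⟨K, hK, hlev⟩ := level n hn
  obtain ⟨N, hN, hgr⟩ := grad_ball n a (by linarith)
  set σ : ℝ := 1 / (2 * √n) with hσ
  have hσ0 : 0 < σ := by positivity
  set κ := (volume (ball (0 : EE n) 1)).toReal with hκ
  have hκ0 : 0 ≤ κ := ENNReal.toReal_nonneg
  set Λ := 2 * C1 * σ ^ (-(a - 1)) with hΛ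
  have hΛ0 : 0 < Λ := by positivity
  refine ⟨16 * Λ ^ 4 * κ + 256 * K * σ ^ 2 * Λ ^ 2 * N, by positivity, ?_⟩
  intro D hD u hu hMu hMw x₀ r hr0 hr1
  set l₀ := Λ * r ^ (-(a - 1)) * D with hl₀
  have hl₀0 : 0 < l₀ := by positivity
  have H : ∀ l, l₀ ≤ l → ENNReal.ofReal (l ^ 4) *
      volume ((ball x₀ r ∩ unitCube n) ∩ {x | 2 * l ≤ |u x|}) ≤
      ENNReal.ofReal (K * σ ^ 2 * r ^ 2 * l₀ ^ 2) *
        ∫⁻ x in (ball x₀ (2 * r) ∩ unitCube n) ∩ {x | l ≤ |u x| ∧ |u x| < 2 * l},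
          ‖fderiv ℝ u x‖ₑ ^ 2 := by
    intro l hl
    have hl0 : 0 < l := by linarith
    have hq1 : l₀ / l ≤ 1 := (div_le_one hl0).2 hl
    have hq0 : 0 < l₀ / l := by positivity
    have ht : σ * r * (l₀ / l) ≤ σ * r := by
      have : 0 < σ * r := by positivity
      nlinarith
    have htr : σ * r * (l₀ / l) ≤ r / (2 * √n) := by
      refine ht.trans (le_of_eq ?_)
      rw [hσ]; ring
    have htσ : σ * r * (l₀ / l) ≤ σ := by nlinarith
    have h1 := hlev u hu x₀ r hr0 hr1 l hl0 (σ * r * (l₀ / l)) (by positivity) htr (by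
      intro x hx
      refine (hav D hD.le u hu hMu hMw x hx _ (by positivity) htσ).trans ?_
      apply ENNReal.ofReal_le_ofReal
      rw [Real.mul_rpow (by positivity) (by positivity), Real.mul_rpow (by positivity)
        (by positivity)]
      have h2 : (l₀ / l) ^ (-(a - 1)) ≤ l / l₀ := by
        rw [← inv_div, Real.inv_rpow (by positivity), Real.rpow_neg (by positivity), inv_inv]
        calc (l / l₀) ^ (a - 1) ≤ (l / l₀) ^ (1:ℝ) := by
              apply Real.rpow_le_rpow_of_exponent_le _ (by linarith)
              rw [le_div_iff₀ hl₀0]; linarith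
          _ = l / l₀ := Real.rpow_one _
      calc C1 * (σ ^ (-(a - 1)) * r ^ (-(a - 1)) * (l₀ / l) ^ (-(a - 1))) * D
          = l₀ / 2 * (l₀ / l) ^ (-(a - 1)) := by rw [hl₀, hΛ]; ring
        _ ≤ l₀ / 2 * (l / l₀) := by gcongr
        _ = l / 2 := by field_simp)
    calc ENNReal.ofReal (l ^ 4) * volume ((ball x₀ r ∩ unitCube n) ∩ {x | 2 * l ≤ |u x|})
        = ENNReal.ofReal (l ^ 2) * (ENNReal.ofReal (l ^ 2) *
          volume ((ball x₀ r ∩ unitCube n) ∩ {x | 2 * l ≤ |u x|})) := by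
          rw [← mul_assoc, ← ENNReal.ofReal_mul (by positivity)]
          congr 2; ring
      _ ≤ _ := mul_le_mul_right h1 _
      _ = _ := by
          rw [← mul_assoc, ← ENNReal.ofReal_mul (by positivity)]
          congr 2; field_simp
  have hBm : ∀ R, MeasurableSet (ball x₀ R ∩ unitCube n) := fun R =>
    measurableSet_ball.inter (measurableSet_unitCube n)
  have hlay := layer n u hu.continuous _ _ (hBm r) (hBm (2 * r)) _ l₀ hl₀0 _ H
  obtain ⟨M, hM⟩ := (isCompact_unitCube n).exists_bound_of_continuousOn hu.continuous.continuousOn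
  obtain ⟨J, hJ⟩ := pow_unbounded_of_one_lt (M / l₀) (one_lt_two)
  rw [div_lt_iff₀ hl₀0] at hJ
  have hG : ∫⁻ x in (ball x₀ (2 * r) ∩ unitCube n) ∩ {x | |u x| < 2 ^ J * l₀},
      ‖fderiv ℝ u x‖ₑ ^ 2 ≤ ENNReal.ofReal (N * r ^ ((n:ℝ) - 2 * a) * D ^ 2) := by
    refine (lintegral_mono_set Set.inter_subset_left).trans ?_
    have := hgr D _ hMw x₀ r hr0
    simpa only [enorm_norm] using this
  have hV : volume (ball x₀ r ∩ unitCube n) ≤ ENNReal.ofReal (r ^ n * κ) := by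
    rw [hκ, ← volume_ball_toReal n hn x₀ r hr0]
    exact measure_mono Set.inter_subset_left
  calc ∫⁻ x in ball x₀ r ∩ unitCube n, ENNReal.ofReal (|u x| ^ 4)
      = ∫⁻ x in ball x₀ r ∩ unitCube n, ENNReal.ofReal (min |u x| (2 * (2 ^ J * l₀)) ^ 4) := by
        apply setLIntegral_congr_fun (hBm r)
        intro x hx
        have := hM x hx.2
        rw [Real.norm_eq_abs] at this
        have h0 : 0 < 2 ^ J * l₀ := by positivity
        simp only
        rw [min_eq_left (by linarith)]
    _ ≤ _ := hlay J
    _ ≤ ENNReal.ofReal ((2 * l₀) ^ 4) * ENNReal.ofReal (r ^ n * κ) +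
        256 * ENNReal.ofReal (K * σ ^ 2 * r ^ 2 * l₀ ^ 2) *
          ENNReal.ofReal (N * r ^ ((n:ℝ) - 2 * a) * D ^ 2) :=
        add_le_add (mul_le_mul_right hV _) (mul_le_mul_right hG _)
    _ = ENNReal.ofReal ((2 * l₀) ^ 4 * (r ^ n * κ) + 256 * (K * σ ^ 2 * r ^ 2 * l₀ ^ 2) *
          (N * r ^ ((n:ℝ) - 2 * a) * D ^ 2)) := by
        rw [ENNReal.ofReal_add (by positivity) (by positivity),
          ENNReal.ofReal_mul (p := (2 * l₀) ^ 4) (by positivity),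
          ENNReal.ofReal_mul (p := 256 * (K * σ ^ 2 * r ^ 2 * l₀ ^ 2)) (by positivity),
          ENNReal.ofReal_mul (p := 256) (by positivity), ENNReal.ofReal_ofNat]
    _ = _ := by
        congr 1
        have e1 : (r ^ (-(a - 1))) ^ 4 * r ^ n = r ^ ((n:ℝ) - 4 * (a - 1)) := by
          rw [← Real.rpow_natCast, ← Real.rpow_natCast, ← Real.rpow_mul hr0.le,
            ← Real.rpow_add hr0]
          congr 1; push_cast; ring
        have e2 : r ^ 2 * (r ^ (-(a - 1))) ^ 2 * r ^ ((n:ℝ) - 2 * a) =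
            r ^ ((n:ℝ) - 4 * (a - 1)) := by
          rw [← Real.rpow_natCast, ← Real.rpow_natCast, ← Real.rpow_mul hr0.le,
            ← Real.rpow_add hr0, ← Real.rpow_add hr0]
          congr 1; push_cast; ring
        calc (2 * l₀) ^ 4 * (r ^ n * κ) + 256 * (K * σ ^ 2 * r ^ 2 * l₀ ^ 2) *
            (N * r ^ ((n:ℝ) - 2 * a) * D ^ 2) =
            16 * Λ ^ 4 * κ * D ^ 4 * ((r ^ (-(a - 1))) ^ 4 * r ^ n) +
            256 * K * σ ^ 2 * Λ ^ 2 * N * D ^ 4 *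
              (r ^ 2 * (r ^ (-(a - 1))) ^ 2 * r ^ ((n:ℝ) - 2 * a)) := by rw [hl₀]; ring
          _ = _ := by rw [e1, e2]; ring

/-- Morrey–Sobolev embedding on the unit cube. -/
theorem morrey_sobolev_embedding (n : ℕ) (hn : 4 ≤ n) (p q : ℝ)
    (hp₁ : (n : ℝ)/2 ≤ p) (hp₂ : p < n) (hq : 1/q = 1/p - 1/(n : ℝ)) :
    ∃ C > 0, ∀ u : EuclideanSpace ℝ (Fin n) → ℝ, ContDiff ℝ (⊤ : ℕ∞) u →
      morreyNorm n q 4 (unitCube n) u ≤ C * morreySobolev1 n p (unitCube n) u := by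
  have hn0 : (0:ℝ) < n := by exact_mod_cast (by omega : 0 < n)
  have hp0 : 0 < p := by linarith
  obtain ⟨C, hC, hcore⟩ := core n hn (n / p) ((one_lt_div hp0).2 hp₂)
    ((div_le_iff₀ hp0).2 (by linarith))
  refine ⟨C ^ (1/4:ℝ), by positivity, ?_⟩
  intro u hu
  have hu1 : ContDiff ℝ 1 u := hu.of_le (by exact_mod_cast le_top)
  have hwc : Continuous (fun y => ‖fderiv ℝ u y‖) := (hu1.continuous_fderiv (by simp)).norm
  obtain ⟨hU0, hU⟩ := morrey_bound n hn p hp0 u hu1.continuous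
  obtain ⟨hW0, hW⟩ := morrey_bound n hn p hp0 _ hwc
  have hlim : ∀ D, morreySobolev1 n p (unitCube n) u < D →
      morreyNorm n q 4 (unitCube n) u ≤ C ^ (1/4:ℝ) * D := by
    intro D hDlt
    rw [morreySobolev1] at hDlt
    have hD : 0 < D := by linarith
    have hMu : MCond n (n / p) D u := by
      intro x R h0 h1
      refine (hU x R h0 h1).trans (ENNReal.ofReal_le_ofReal ?_)
      gcongr
      linarith
    have hMw : MCond n (n / p) D (fun y => ‖fderiv ℝ u y‖) := by
      intro x R h0 h1
      refine (hW x R h0 h1).trans (ENNReal.ofReal_le_ofReal ?_)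
      gcongr
      linarith
    have : Nonempty (Set.Ioc (0:ℝ) 1) := ⟨⟨1, by norm_num⟩⟩
    refine ciSup_le fun x₀ => ciSup_le ?_
    rintro ⟨r, hr0, hr1⟩
    simp only
    have h := hcore D hD u hu1 hMu hMw x₀ r hr0 hr1
    have hI : ∫ y in ball x₀ r ∩ unitCube n, |u y| ^ (4:ℝ) ≤
        C * D ^ 4 * r ^ ((n:ℝ) - 4 * (n / p - 1)) := by
      rw [← ENNReal.ofReal_le_ofReal_iff (by positivity), ofReal_integral_eq_lintegral_ofReal
        (integrableOn_pow n u hu1.continuous 4 (by norm_num) x₀ r)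
        (Filter.Eventually.of_forall fun y => by positivity)]
      refine le_trans (le_of_eq ?_) h
      apply lintegral_congr
      intro y
      congr 1
      exact_mod_cast Real.rpow_natCast |u y| 4
    calc r ^ ((n : ℝ) * (1/q - 1/4)) *
          (∫ y in ball x₀ r ∩ unitCube n, |u y| ^ (4:ℝ)) ^ (1/4:ℝ)
        ≤ r ^ ((n : ℝ) * (1/q - 1/4)) *
          (C * D ^ 4 * r ^ ((n:ℝ) - 4 * (n / p - 1))) ^ (1/4:ℝ) := by
          have : 0 ≤ ∫ y in ball x₀ r ∩ unitCube n, |u y| ^ (4:ℝ) :=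
            integral_nonneg fun y => by positivity
          gcongr
      _ = C ^ (1/4:ℝ) * D := by
          rw [Real.mul_rpow (by positivity) (by positivity),
            Real.mul_rpow (by positivity) (by positivity), ← Real.rpow_natCast D,
            ← Real.rpow_mul hD.le, ← Real.rpow_mul hr0.le, hq]
          have e : r ^ ((n : ℝ) * (1/p - 1/(n:ℝ) - 1/4)) *
              r ^ (((n:ℝ) - 4 * (n / p - 1)) * (1/4)) = 1 := by
            rw [← Real.rpow_add hr0]
            rw [show (n : ℝ) * (1/p - 1/(n:ℝ) - 1/4) + ((n:ℝ) - 4 * (n / p - 1)) * (1/4) = 0 by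
              field_simp; ring]
            simp
          have e2 : D ^ (((4:ℕ):ℝ) * (1/4)) = D := by norm_num
          rw [e2]
          linear_combination (C ^ (1/4:ℝ) * D) * e
  apply le_of_forall_pos_le_add
  intro ε hε
  have hCC : 0 < C ^ (1/4:ℝ) := by positivity
  have := hlim (morreySobolev1 n p (unitCube n) u + ε / C ^ (1/4:ℝ))
    (by linarith [div_pos hε hCC])
  rw [mul_add, mul_div_cancel₀ _ hCC.ne'] at this
  exact this
end

section
/- Product estimate: ‖uv‖_{M^{n/2}_2([0,1]ⁿ)} ≤ C ‖u‖_{M^{n/2}_{2,1}([0,1]ⁿ)} ‖v‖_{M^{n/2}_{2,1}([0,1]ⁿ)} for smooth u, v on [0,1]ⁿ, n ≥ 4. -/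
open MeasureTheory Metric

open scoped ENNReal

namespace MorreyAux

abbrev Eu (n : ℕ) := EuclideanSpace ℝ (Fin n)

def dy {n : ℕ} (k : ℕ) (x : Eu n) : Set (Eu n) :=
  {y | ∀ i, ⌊(2:ℝ)^k * y i⌋ = ⌊(2:ℝ)^k * x i⌋}

variable {n : ℕ}

lemma mem_dy_self (k : ℕ) (x : Eu n) : x ∈ dy k x := fun _ => rfl

lemma mem_dy_symm {k : ℕ} {x y : Eu n} (h : y ∈ dy k x) : x ∈ dy k y := fun i => (h i).symm

lemma dy_eq {k : ℕ} {x y : Eu n} (h : y ∈ dy k x) : dy k y = dy k x := by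
  ext z
  simp only [dy, Set.mem_ofPred_eq] at *
  exact forall_congr' fun i => by rw [h i]

lemma dy_succ (k : ℕ) (x : Eu n) : dy (k+1) x ⊆ dy k x := by
  intro y hy i
  have h := hy i
  have key : ∀ t : ℝ, ⌊(2:ℝ)^k * t⌋ = ⌊(2:ℝ)^(k+1) * t⌋ / 2 := by
    intro t
    have := Int.floor_div_natCast ((2:ℝ)^(k+1) * t) 2
    rw [show (2:ℝ)^k * t = (2:ℝ)^(k+1) * t / (2:ℕ) by push_cast; ring]
    exact_mod_cast this
  rw [key, key, h]

lemma dy_anti {k l : ℕ} (h : k ≤ l) (x : Eu n) : dy l x ⊆ dy k x := by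
  induction l, h using Nat.le_induction with
  | base => exact subset_rfl
  | succ l _ ih => exact (dy_succ l x).trans ih

lemma mem_dy_iff {k : ℕ} {x y : Eu n} : y ∈ dy k x ↔
    ∀ i, y i ∈ Set.Ico ((⌊(2:ℝ)^k * x i⌋ : ℝ) / 2^k) ((⌊(2:ℝ)^k * x i⌋ + 1 : ℝ) / 2^k) := by
  simp only [dy, Set.mem_ofPred_eq]
  refine forall_congr' fun i => ?_
  rw [Int.floor_eq_iff, Set.mem_Ico, div_le_iff₀ (by positivity), lt_div_iff₀ (by positivity),
    mul_comm (y i)]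

lemma dy_measurable_prod (k : ℕ) : MeasurableSet {p : Eu n × Eu n | p.2 ∈ dy k p.1} := by
  simp only [dy, Set.mem_ofPred_eq]
  rw [Set.ofPred_forall]
  refine MeasurableSet.iInter fun i => ?_
  refine measurableSet_eq_fun ?_ ?_
  · exact Int.measurable_floor.comp (by fun_prop)
  · exact Int.measurable_floor.comp (by fun_prop)

lemma dy_measurable (k : ℕ) (x : Eu n) : MeasurableSet (dy k x) :=
  measurable_prodMk_left (x := x) (dy_measurable_prod (n := n) k)

lemma dy_convex (k : ℕ) (x : Eu n) : Convex ℝ (dy k x) := by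
  intro y hy z hz a b ha hb hab
  rw [mem_dy_iff] at *
  intro i
  exact (convex_Ico _ _) (hy i) (hz i) ha hb hab

lemma dy_volume (k : ℕ) (x : Eu n) : (2:ℝ≥0∞)^(k*n) * volume (dy k x) = 1 := by
  have h : dy k x = (MeasurableEquiv.toLp 2 (Fin n → ℝ)).symm ⁻¹'
      (Set.univ.pi fun i => Set.Ico ((⌊(2:ℝ)^k * x i⌋ : ℝ) / 2^k) ((⌊(2:ℝ)^k * x i⌋ + 1 : ℝ) / 2^k)) := by
    ext y
    rw [mem_dy_iff]
    simp
  rw [h, (EuclideanSpace.volume_preserving_symm_measurableEquiv_toLp (Fin n)).measure_preimage_equiv,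
    Real.volume_pi_Ico]
  have : ∀ i, ENNReal.ofReal ((⌊(2:ℝ)^k * x i⌋ + 1 : ℝ) / 2^k - (⌊(2:ℝ)^k * x i⌋ : ℝ) / 2^k) = ((2:ℝ≥0∞)^k)⁻¹ := by
    intro i
    rw [← sub_div, add_sub_cancel_left, one_div, ENNReal.ofReal_inv_of_pos (by positivity),
      ENNReal.ofReal_pow (by norm_num)]
    simp
  simp only [this, Finset.prod_const, Finset.card_univ, Fintype.card_fin]
  rw [pow_mul, ← mul_pow, ENNReal.mul_inv_cancel (by simp) (by simp), one_pow]

lemma dy_dist {k : ℕ} {x y z : Eu n} (hy : y ∈ dy k x) (hz : z ∈ dy k x) :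
    dist y z ≤ n * ((2:ℝ)^k)⁻¹ := by
  rw [mem_dy_iff] at hy hz
  have h2 : (0:ℝ) < 2^k := by positivity
  have hi : ∀ i, dist (y i) (z i) ^ 2 ≤ (((2:ℝ)^k)⁻¹)^2 := by
    intro i
    have h1 := hy i
    have h3 := hz i
    simp only [Set.mem_Ico, add_div, one_div] at h1 h3
    rw [Real.dist_eq, sq_abs]
    refine sq_le_sq' ?_ ?_ <;> linarith
  rw [EuclideanSpace.dist_eq]
  calc √(∑ i, dist (y i) (z i) ^ 2) ≤ √(∑ i : Fin n, (((2:ℝ)^k)⁻¹)^2) :=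
        Real.sqrt_le_sqrt (Finset.sum_le_sum fun i _ => hi i)
    _ = √(n * (((2:ℝ)^k)⁻¹)^2) := by simp
    _ ≤ √((n * ((2:ℝ)^k)⁻¹)^2) := by
        apply Real.sqrt_le_sqrt
        rw [mul_pow]
        gcongr
        rcases Nat.eq_zero_or_pos n with h | h
        · simp [h]
        · have : (1:ℝ) ≤ n := by exact_mod_cast h
          nlinarith
    _ = _ := Real.sqrt_sq (by positivity)

/-- averages -/
noncomputable def av (k : ℕ) (f : Eu n → ℝ≥0∞) (x : Eu n) : ℝ≥0∞ :=
  2^(k*n) * ∫⁻ y in dy k x, f y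

lemma av_const (k : ℕ) (c : ℝ≥0∞) (x : Eu n) : av k (fun _ => c) x = c := by
  rw [av, setLIntegral_const, mul_left_comm, dy_volume, mul_one]

lemma av_mono {k : ℕ} {f g : Eu n → ℝ≥0∞} {x : Eu n} (h : ∀ y ∈ dy k x, f y ≤ g y) :
    av k f x ≤ av k g x := by
  unfold av
  gcongr 1
  exact setLIntegral_mono' (dy_measurable k x) h

lemma av_add {k : ℕ} {f g : Eu n → ℝ≥0∞} (hf : Measurable f) (x : Eu n) :
    av k (fun y => f y + g y) x = av k f x + av k g x := by
  unfold av
  rw [lintegral_add_left hf, mul_add]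

lemma av_const_mul {k : ℕ} {f : Eu n → ℝ≥0∞} (hf : Measurable f) (c : ℝ≥0∞) (x : Eu n) :
    av k (fun y => c * f y) x = c * av k f x := by
  unfold av
  rw [lintegral_const_mul c hf, mul_left_comm]

lemma av_congr {k : ℕ} {f : Eu n → ℝ≥0∞} {x y : Eu n} (h : y ∈ dy k x) : av k f y = av k f x := by
  unfold av
  rw [dy_eq h]

lemma av_eq_ind (k : ℕ) (f : Eu n → ℝ≥0∞) (x : Eu n) :
    av k f x = 2^(k*n) * ∫⁻ y, {p : Eu n × Eu n | p.2 ∈ dy k p.1}.indicator (fun p => f p.2) (x, y) := by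
  unfold av
  rw [← lintegral_indicator (dy_measurable k x)]
  rfl

lemma ind_measurable (k : ℕ) {f : Eu n → ℝ≥0∞} (hf : Measurable f) :
    Measurable ({p : Eu n × Eu n | p.2 ∈ dy k p.1}.indicator (fun p => f p.2)) :=
  (hf.comp measurable_snd).indicator (dy_measurable_prod k)

lemma av_measurable (k : ℕ) {f : Eu n → ℝ≥0∞} (hf : Measurable f) : Measurable (av k f) := by
  have : av k f = fun x => 2^(k*n) * ∫⁻ y, {p : Eu n × Eu n | p.2 ∈ dy k p.1}.indicator (fun p => f p.2) (x, y) := by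
    ext x; exact av_eq_ind k f x
  rw [this]
  exact (ind_measurable k hf).lintegral_prod_right'.const_mul _

lemma av_int (k : ℕ) {f h : Eu n → ℝ≥0∞} (hf : Measurable f) (hh : Measurable h)
    (hc : ∀ x y, y ∈ dy k x → h y = h x) :
    ∫⁻ x, av k f x * h x = ∫⁻ x, f x * h x := by
  have h1 : ∀ x, av k f x * h x = 2^(k*n) * ∫⁻ y,
      {p : Eu n × Eu n | p.2 ∈ dy k p.1}.indicator (fun p => f p.2 * h p.2) (x, y) := by
    intro x
    rw [← av_eq_ind k (fun y => f y * h y)]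
    unfold av
    rw [mul_assoc, ← lintegral_mul_const _ hf]
    congr 1
    refine setLIntegral_congr_fun (dy_measurable k x) fun y hy => ?_
    simp only [hc x y hy]
  simp_rw [h1]
  have hm : Measurable ({p : Eu n × Eu n | p.2 ∈ dy k p.1}.indicator
      (fun p => f p.2 * h p.2)) := ind_measurable k (hf.mul hh)
  rw [lintegral_const_mul _ hm.lintegral_prod_right']
  rw [lintegral_lintegral_swap (f := fun x y => ({p : Eu n × Eu n | p.2 ∈ dy k p.1}.indicator
      (fun p => f p.2 * h p.2)) (x, y)) hm.aemeasurable]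
  have h2 : ∀ y, ∫⁻ x, {p : Eu n × Eu n | p.2 ∈ dy k p.1}.indicator (fun p => f p.2 * h p.2) (x, y)
      = (f y * h y) * volume (dy k y) := by
    intro y
    rw [← lintegral_indicator_const (dy_measurable k y)]
    refine lintegral_congr fun x => ?_
    have : y ∈ dy k x ↔ x ∈ dy k y := ⟨mem_dy_symm, mem_dy_symm⟩
    by_cases hx : x ∈ dy k y
    · rw [Set.indicator_of_mem hx, Set.indicator_of_mem (by exact this.2 hx)]
    · rw [Set.indicator_of_notMem hx, Set.indicator_of_notMem (by exact fun h => hx (this.1 h))]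
  simp_rw [h2]
  rw [← lintegral_const_mul']
  · congr 1
    ext y
    rw [mul_left_comm, dy_volume, mul_one]
  · simp

lemma av_int' (k : ℕ) {f : Eu n → ℝ≥0∞} (hf : Measurable f) :
    ∫⁻ x, av k f x = ∫⁻ x, f x := by
  simpa using av_int k hf (h := fun _ => 1) measurable_const (fun _ _ _ => rfl)

lemma av_succ_le (k : ℕ) (f : Eu n → ℝ≥0∞) (x : Eu n) : av (k+1) f x ≤ 2^n * av k f x := by
  unfold av
  rw [← mul_assoc, ← pow_add, show n + k * n = (k+1)*n by ring]
  gcongr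
  exact dy_succ k x

lemma av_sq_le (k : ℕ) {f : Eu n → ℝ≥0∞} (hf : Measurable f) (x : Eu n) :
    (av k f x)^2 ≤ av k (fun y => f y ^2) x := by
  set D := dy k x
  have h := ENNReal.lintegral_mul_le_Lp_mul_Lq (volume.restrict D) Real.HolderConjugate.two_two
    hf.aemeasurable (g := fun _ => 1) aemeasurable_const
  simp only [Pi.mul_apply, mul_one, ENNReal.one_rpow, lintegral_one, Measure.restrict_apply_univ] at h
  have h2 : (∫⁻ y in D, f y)^2 ≤ (∫⁻ y in D, f y^2) * volume D := by
    calc _ ≤ _ := pow_le_pow_left' h 2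
      _ = _ := by
        rw [mul_pow, ← ENNReal.rpow_natCast, ← ENNReal.rpow_mul, ← ENNReal.rpow_natCast, ← ENNReal.rpow_mul]
        norm_num
  unfold av
  calc _ = 2^(k*n) * (2^(k*n) * (∫⁻ y in D, f y)^2) := by ring
    _ ≤ 2^(k*n) * (2^(k*n) * ((∫⁻ y in D, f y^2) * volume D)) := by gcongr
    _ = (2^(k*n) * ∫⁻ y in D, f y^2) * (2^(k*n) * volume D) := by ring
    _ = _ := by rw [dy_volume, mul_one]


noncomputable def mx (j : ℕ) (f : Eu n → ℝ≥0∞) : ℕ → Eu n → ℝ≥0∞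
  | 0 => av j f
  | N+1 => fun x => max (mx j f N x) (av (j+(N+1)) f x)

lemma mx_measurable (j : ℕ) {f : Eu n → ℝ≥0∞} (hf : Measurable f) (N : ℕ) :
    Measurable (mx j f N) := by
  induction N with
  | zero => exact av_measurable j hf
  | succ N ih => exact ih.max (av_measurable _ hf)

lemma mx_congr (j : ℕ) (f : Eu n → ℝ≥0∞) (N : ℕ) :
    ∀ x y, y ∈ dy (j+N) x → mx j f N y = mx j f N x := by
  induction N with
  | zero => intro x y h; exact av_congr h
  | succ N ih =>
    intro x y h
    simp only [mx]
    rw [ih x y (dy_succ _ _ h), av_congr h]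

lemma mx_le (j : ℕ) {f : Eu n → ℝ≥0∞} {B : ℝ≥0∞} (hB : ∀ x, f x ≤ B) (N : ℕ) (x : Eu n) :
    mx j f N x ≤ B := by
  have h : ∀ k, av k f x ≤ B := fun k =>
    (av_mono (fun y _ => hB y)).trans_eq (av_const k B x)
  induction N with
  | zero => exact h _
  | succ N ih => exact max_le ih (h _)

lemma two_mul_le (a b : ℝ≥0∞) : 2 * (a * b) ≤ a^2 + b^2 := by
  rcases eq_or_ne a ⊤ with rfl | ha
  · simp
  rcases eq_or_ne b ⊤ with rfl | hb
  · simp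
  lift a to NNReal using ha
  lift b to NNReal using hb
  norm_cast
  rw [← NNReal.coe_le_coe]
  push_cast
  nlinarith [sq_nonneg ((a:ℝ) - b)]

lemma sq_aux (m x : ℝ≥0∞) : (max m x)^2 + 2 * (x * m) ≤ m^2 + 2 * (x * max m x) := by
  rcases le_total x m with h | h
  · rw [max_eq_left h]
  · rw [max_eq_right h]
    calc x^2 + 2 * (x * m) ≤ x^2 + (x^2 + m^2) := by gcongr; exact two_mul_le x m
      _ = _ := by ring

lemma doob_step (j : ℕ) {f : Eu n → ℝ≥0∞} (hf : Measurable f)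
    (hfin : ∀ N, ∫⁻ x, f x * mx j f N x ≠ ⊤) (N : ℕ) :
    ∫⁻ x, (mx j f N x)^2 ≤ 2 * ∫⁻ x, f x * mx j f N x := by
  induction N with
  | zero =>
    have : ∫⁻ x, (mx j f 0 x)^2 = ∫⁻ x, f x * mx j f 0 x := by
      rw [← av_int j hf (mx_measurable j hf 0) (mx_congr j f 0)]
      simp only [mx, sq]
    rw [this, two_mul]
    exact le_self_add
  | succ N ih =>
    have hm := mx_measurable j hf N
    have hm' := mx_measurable j hf (N+1)
    have h1 : ∫⁻ x, av (j+(N+1)) f x * mx j f N x = ∫⁻ x, f x * mx j f N x :=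
      av_int _ hf hm (fun x y h => mx_congr j f N x y (dy_succ _ _ h))
    have h2 : ∫⁻ x, av (j+(N+1)) f x * mx j f (N+1) x = ∫⁻ x, f x * mx j f (N+1) x :=
      av_int _ hf hm' (mx_congr j f (N+1))
    have ha := av_measurable (j+(N+1)) hf
    have h3 : ∫⁻ x, ((mx j f (N+1) x)^2 + 2 * (av (j+(N+1)) f x * mx j f N x)) ≤
        ∫⁻ x, ((mx j f N x)^2 + 2 * (av (j+(N+1)) f x * mx j f (N+1) x)) :=
      lintegral_mono fun x => sq_aux _ _
    rw [lintegral_add_left (hm'.pow_const 2), lintegral_add_left (hm.pow_const 2),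
      lintegral_const_mul' _ _ (by simp), lintegral_const_mul' _ _ (by simp), h1, h2] at h3
    have h4 := h3.trans (add_le_add_left ih _)
    rw [add_comm] at h4
    exact (ENNReal.add_le_add_iff_left (ENNReal.mul_ne_top (by simp) (hfin N))).1 h4

lemma doob_fin (j : ℕ) {f : Eu n → ℝ≥0∞} (hf : Measurable f)
    (hfin : ∀ N, ∫⁻ x, f x * mx j f N x ≠ ⊤) (N : ℕ) :
    ∫⁻ x, (mx j f N x)^2 ≤ 4 * ∫⁻ x, f x ^ 2 := by
  have h := doob_step j hf hfin N
  have hm := mx_measurable j hf N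
  have h1 : ∫⁻ x, 2 * (2 * f x * mx j f N x) ≤ ∫⁻ x, ((2 * f x)^2 + (mx j f N x)^2) :=
    lintegral_mono fun x => two_mul_le _ _
  rw [lintegral_add_right _ (hm.pow_const 2), lintegral_const_mul' _ _ (by simp)] at h1
  simp_rw [mul_pow, mul_assoc] at h1
  rw [lintegral_const_mul' _ _ (by simp), lintegral_const_mul' _ _ (by simp)] at h1
  have h2 : (∫⁻ x, (mx j f N x)^2) + ∫⁻ x, (mx j f N x)^2 ≤
      (2 ^ 2 * ∫⁻ x, f x ^ 2) + ∫⁻ x, (mx j f N x)^2 := by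
    rw [← two_mul]
    exact (mul_le_mul_right h 2).trans h1
  have h3 : ∫⁻ x, (mx j f N x)^2 ≠ ⊤ :=
    ne_top_of_le_ne_top (ENNReal.mul_ne_top (by simp) (hfin N)) h
  have h4 := (ENNReal.add_le_add_iff_right h3).1 h2
  convert h4 using 2
  norm_num

lemma av_le_mx (j : ℕ) (f : Eu n → ℝ≥0∞) {N i : ℕ} (h : i ≤ N) (x : Eu n) :
    av (j+i) f x ≤ mx j f N x := by
  induction N with
  | zero => obtain rfl : i = 0 := by omega
            exact le_rfl
  | succ N ih =>
    rcases Nat.lt_or_ge i (N+1) with h' | h'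
    · exact (ih (by omega)).trans (le_max_left _ _)
    · obtain rfl : i = N+1 := by omega
      exact le_max_right _ _

/-- dyadic maximal theorem, local form. -/
lemma doob (j : ℕ) (x₀ : Eu n) {g : Eu n → ℝ≥0∞} (hg : Measurable g) {B : ℝ≥0∞} (hB : B ≠ ⊤)
    (hgB : ∀ x ∈ dy j x₀, g x ≤ B) :
    ∃ M : Eu n → ℝ≥0∞, Measurable M ∧ (∀ x, M x ≤ B) ∧
      (∀ x ∈ dy j x₀, ∀ k, j ≤ k → av k g x ≤ M x) ∧
      ∫⁻ x in dy j x₀, M x ^ 2 ≤ 4 * ∫⁻ x in dy j x₀, g x ^ 2 := by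
  set D := dy j x₀
  have hD : MeasurableSet D := dy_measurable j x₀
  set f := D.indicator g
  have hf : Measurable f := hg.indicator hD
  have hfB : ∀ x, f x ≤ B := fun x => by
    by_cases hx : x ∈ D
    · simp only [f, Set.indicator_of_mem hx]; exact hgB x hx
    · simp [f, Set.indicator_of_notMem hx]
  have hvol : volume D ≠ ⊤ := by
    intro h
    have := dy_volume j x₀
    rw [show volume (dy j x₀) = ⊤ from h, ENNReal.mul_top (by simp)] at this
    simp at this
  have hfin : ∀ N, ∫⁻ x, f x * mx j f N x ≠ ⊤ := by
    intro N
    have : ∫⁻ x, f x * mx j f N x ≤ ∫⁻ x, D.indicator (fun _ => B * B) x := by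
      refine lintegral_mono fun x => ?_
      by_cases hx : x ∈ D
      · rw [Set.indicator_of_mem hx]; exact mul_le_mul' (hfB x) (mx_le j hfB N x)
      · simp [f, Set.indicator_of_notMem hx]
    rw [lintegral_indicator_const hD] at this
    exact ne_top_of_le_ne_top (ENNReal.mul_ne_top (ENNReal.mul_ne_top hB hB) hvol) this
  have hmono : Monotone (mx j f) := monotone_nat_of_le_succ fun N x => le_max_left _ _
  refine ⟨fun x => ⨆ N, mx j f N x, Measurable.iSup fun N => mx_measurable j hf N,
    fun x => iSup_le fun N => mx_le j hfB N x, ?_, ?_⟩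
  · intro x hx k hk
    have : av k g x ≤ av k f x := av_mono fun y hy => by
      have : y ∈ D := by
        have h1 := dy_anti hk x hy
        rwa [dy_eq hx] at h1
      simp [f, Set.indicator_of_mem this]
    refine this.trans ?_
    obtain ⟨i, rfl⟩ := Nat.exists_eq_add_of_le hk
    exact (av_le_mx j f le_rfl x).trans (le_iSup (fun N => mx j f N x) i)
  · have h1 : ∫⁻ x in D, g x ^ 2 = ∫⁻ x, f x ^ 2 := by
      rw [← lintegral_indicator hD]
      congr 1
      ext x
      by_cases hx : x ∈ D <;> simp [f, hx]
    rw [h1]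
    refine (setLIntegral_le_lintegral _ _).trans ?_
    have h2 : ∀ x, (⨆ N, mx j f N x)^2 = ⨆ N, (mx j f N x)^2 := fun x =>
      ENNReal.iSup_pow _ 2
    simp_rw [h2]
    rw [lintegral_iSup (fun N => (mx_measurable j hf N).pow_const 2)
      (fun a b hab x => pow_le_pow_left' (hmono hab x) 2)]
    exact iSup_le fun N => doob_fin j hf hfin N


lemma lint_smul (g : Eu n → ℝ≥0∞) (hg : Measurable g) {t : ℝ} (ht : 1/2 ≤ t) (a : Eu n) :
    ∫⁻ z, g (a + t • z) ≤ 2^n * ∫⁻ z, g z := by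
  have ht0 : t ≠ 0 := by linarith
  have h1 : ∫⁻ z, g (a + t • z) = ∫⁻ z, g (a + z) ∂(Measure.map (t • ·) volume) := by
    rw [lintegral_map (f := fun z => g (a + z)) (hg.comp (measurable_const_add a))
      (measurable_const_smul t)]
  rw [h1, Measure.map_addHaar_smul volume ht0, lintegral_smul_measure,
    lintegral_add_left_eq_self, smul_eq_mul]
  gcongr
  rw [finrank_euclideanSpace_fin, abs_of_nonneg (by positivity), ← inv_pow,
    ENNReal.ofReal_pow (by positivity)]
  gcongr
  rw [show (2:ℝ≥0∞) = ENNReal.ofReal 2 by simp]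
  apply ENNReal.ofReal_le_ofReal
  rw [inv_le_comm₀ (by linarith) (by norm_num)]
  linarith

lemma seg_int {g : Eu n → ℝ≥0∞} (hg : Measurable g) {D : Set (Eu n)} (hD : MeasurableSet D)
    (hc : Convex ℝ D) {t : ℝ} (ht : 1/2 ≤ t) (ht1 : t ≤ 1) :
    ∫⁻ y in D, ∫⁻ z in D, g (y + t • (z - y)) ≤ 2^n * volume D * ∫⁻ z in D, g z := by
  have h : ∀ y ∈ D, ∫⁻ z in D, g (y + t • (z - y)) ≤ 2^n * ∫⁻ z in D, g z := by
    intro y hy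
    calc ∫⁻ z in D, g (y + t • (z - y)) ≤ ∫⁻ z in D, D.indicator g ((y - t • y) + t • z) := by
          refine setLIntegral_mono' hD fun z hz => ?_
          have : y + t • (z - y) ∈ D := by
            have := hc hy hz (by linarith : 0 ≤ 1 - t) (by linarith : 0 ≤ t) (by ring)
            convert this using 1
            module
          rw [show y - t • y + t • z = y + t • (z - y) by module, Set.indicator_of_mem this]
      _ ≤ ∫⁻ z, D.indicator g ((y - t • y) + t • z) := setLIntegral_le_lintegral _ _
      _ ≤ 2^n * ∫⁻ z, D.indicator g z := lint_smul _ (hg.indicator hD) ht _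
      _ = _ := by rw [lintegral_indicator hD]
  calc _ ≤ ∫⁻ y in D, 2^n * ∫⁻ z in D, g z := setLIntegral_mono' hD h
    _ = _ := by rw [setLIntegral_const]; ring

lemma seg_int' {g : Eu n → ℝ≥0∞} (hg : Measurable g) {D : Set (Eu n)} (hD : MeasurableSet D)
    (hc : Convex ℝ D) {t : ℝ} (ht : 0 ≤ t) (ht1 : t ≤ 1) :
    ∫⁻ y in D, ∫⁻ z in D, g (y + t • (z - y)) ≤ 2^n * volume D * ∫⁻ z in D, g z := by
  rcases le_total (1/2) t with h | h
  · exact seg_int hg hD hc h ht1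
  · rw [lintegral_lintegral_swap]
    · refine le_trans (le_of_eq ?_) (seg_int hg hD hc (t := 1 - t) (by linarith) (by linarith))
      refine lintegral_congr fun y => lintegral_congr fun z => ?_
      congr 1
      module
    · refine Measurable.aemeasurable ?_
      refine hg.comp ?_
      fun_prop

lemma ftc {u : Eu n → ℝ} (hu : ContDiff ℝ 1 u) (y z : Eu n) :
    ‖u z - u y‖ₑ ≤ ‖z - y‖ₑ * ∫⁻ t in Set.Icc (0:ℝ) 1, ‖fderiv ℝ u (y + t • (z - y))‖ₑ := by
  have hd : ∀ t : ℝ, HasDerivAt (fun t : ℝ => u (y + t • (z - y)))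
      (fderiv ℝ u (y + t • (z - y)) (z - y)) t := by
    intro t
    have h1 : HasDerivAt (fun t : ℝ => y + t • (z - y)) (z - y) t := by
      simpa using ((hasDerivAt_id t).smul_const (z - y)).const_add y
    exact ((hu.differentiable one_ne_zero _).hasFDerivAt).comp_hasDerivAt t h1
  have hcf : Continuous (fderiv ℝ u) := hu.continuous_fderiv one_ne_zero
  have hc : Continuous fun t : ℝ => fderiv ℝ u (y + t • (z - y)) (z - y) := by fun_prop
  have h := intervalIntegral.integral_eq_sub_of_hasDerivAt (a := 0) (b := 1) (fun t _ => hd t)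
    (hc.intervalIntegrable _ _)
  simp only [one_smul, zero_smul, add_zero, add_sub_cancel] at h
  rw [← h, intervalIntegral.integral_of_le zero_le_one]
  refine (enorm_integral_le_lintegral_enorm _).trans ?_
  rw [← lintegral_const_mul' _ _ (by simp)]
  refine (lintegral_mono_set Set.Ioc_subset_Icc_self).trans (lintegral_mono fun t => ?_)
  rw [mul_comm]
  exact ContinuousLinearMap.le_opENorm _ _

lemma poinc {u : Eu n → ℝ} (hu : ContDiff ℝ 1 u) (k : ℕ) (x : Eu n) :
    av k (fun y => av k (fun z => ‖u z - u y‖ₑ) x) x ≤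
      (n * 2^n) * (((2:ℝ≥0∞)^k)⁻¹ * av k (fun y => ‖fderiv ℝ u y‖ₑ) x) := by
  set D := dy k x with hDdef
  have hD : MeasurableSet D := dy_measurable k x
  set g : Eu n → ℝ≥0∞ := fun y => ‖fderiv ℝ u y‖ₑ with hg
  have hcf : Continuous (fderiv ℝ u) := hu.continuous_fderiv one_ne_zero
  have hgm : Measurable g := hcf.enorm.measurable
  have hm3 : Measurable fun p : (Eu n × Eu n) × ℝ => g (p.1.1 + p.2 • (p.1.2 - p.1.1)) := by
    refine hgm.comp ?_
    fun_prop
  have h1 : ∫⁻ y in D, ∫⁻ z in D, ‖u z - u y‖ₑ ≤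
      (n * ((2:ℝ≥0∞)^k)⁻¹) * ∫⁻ y in D, ∫⁻ z in D, ∫⁻ t in Set.Icc (0:ℝ) 1, g (y + t • (z - y)) := by
    rw [← lintegral_const_mul' _ _ (by simp [ENNReal.mul_eq_top])]
    refine setLIntegral_mono' hD fun y hy => ?_
    rw [← lintegral_const_mul' _ _ (by simp [ENNReal.mul_eq_top])]
    refine setLIntegral_mono' hD fun z hz => ?_
    refine (ftc hu y z).trans ?_
    gcongr
    have := dy_dist hz hy
    rw [dist_eq_norm] at this
    rw [← ofReal_norm]
    refine (ENNReal.ofReal_le_ofReal this).trans (le_of_eq ?_)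
    rw [ENNReal.ofReal_mul (by positivity), ENNReal.ofReal_inv_of_pos (by positivity),
      ENNReal.ofReal_pow (by norm_num)]
    simp
  have h2 : ∫⁻ y in D, ∫⁻ z in D, ∫⁻ t in Set.Icc (0:ℝ) 1, g (y + t • (z - y)) ≤
      2^n * volume D * ∫⁻ z in D, g z := by
    have e1 : ∀ y, ∫⁻ z in D, ∫⁻ t in Set.Icc (0:ℝ) 1, g (y + t • (z - y)) =
        ∫⁻ t in Set.Icc (0:ℝ) 1, ∫⁻ z in D, g (y + t • (z - y)) := by
      intro y
      refine lintegral_lintegral_swap (Measurable.aemeasurable ?_)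
      refine hgm.comp ?_
      fun_prop
    simp_rw [e1]
    rw [lintegral_lintegral_swap]
    · calc _ ≤ ∫⁻ t in Set.Icc (0:ℝ) 1, 2^n * volume D * ∫⁻ z in D, g z := by
            refine setLIntegral_mono' measurableSet_Icc fun t ht => ?_
            exact seg_int' hgm hD (dy_convex k x) ht.1 ht.2
        _ = _ := by rw [setLIntegral_const]; simp
    · refine Measurable.aemeasurable ?_
      have : Measurable fun p : (Eu n × ℝ) × Eu n => g (p.1.1 + p.1.2 • (p.2 - p.1.1)) := by
        refine hgm.comp ?_
        fun_prop
      exact this.lintegral_prod_right'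
  unfold av
  rw [lintegral_const_mul' _ _ (by simp)]
  calc _ ≤ 2^(k*n) * (2^(k*n) * ((n * ((2:ℝ≥0∞)^k)⁻¹) * (2^n * volume D * ∫⁻ z in D, g z))) := by
        gcongr
        exact h1.trans (by gcongr)
    _ = (n * 2^n) * (((2:ℝ≥0∞)^k)⁻¹ * (2^(k*n) * ∫⁻ z in D, g z)) * (2^(k*n) * volume D) := by ring
    _ = _ := by rw [dy_volume, mul_one]

/-- one telescoping step -/
lemma tele_step {u : Eu n → ℝ} (hu : ContDiff ℝ 1 u) (k : ℕ) (x : Eu n) :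
    av k (fun y => ‖u y - u x‖ₑ) x ≤ av (k+1) (fun y => ‖u y - u x‖ₑ) x +
      (n * 4^n) * (((2:ℝ≥0∞)^k)⁻¹ * av k (fun y => ‖fderiv ℝ u y‖ₑ) x) := by
  have hc := hu.continuous
  have hp : ∀ y, ‖u y - u x‖ₑ ≤ av (k+1) (fun z => ‖u z - u x‖ₑ) x +
      2^n * av k (fun z => ‖u z - u y‖ₑ) x := by
    intro y
    calc ‖u y - u x‖ₑ = av (k+1) (fun z => ‖u y - u x‖ₑ) x := (av_const _ _ _).symm
      _ ≤ av (k+1) (fun z => ‖u z - u x‖ₑ + ‖u z - u y‖ₑ) x := by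
          refine av_mono fun z _ => ?_
          rw [show u y - u x = (u z - u x) - (u z - u y) by ring]
          exact enorm_sub_le
      _ = av (k+1) (fun z => ‖u z - u x‖ₑ) x + av (k+1) (fun z => ‖u z - u y‖ₑ) x :=
          av_add (by fun_prop) x
      _ ≤ _ := by gcongr; exact av_succ_le _ _ _
  calc _ ≤ av k (fun y => av (k+1) (fun z => ‖u z - u x‖ₑ) x +
      2^n * av k (fun z => ‖u z - u y‖ₑ) x) x := av_mono fun y _ => hp y
    _ = av (k+1) (fun z => ‖u z - u x‖ₑ) x + 2^n * av k (fun y => av k (fun z => ‖u z - u y‖ₑ) x) x := by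
        rw [av_add measurable_const, av_const, av_const_mul]
        unfold av
        refine Measurable.const_mul ?_ _
        have : Measurable fun p : Eu n × Eu n => ‖u p.2 - u p.1‖ₑ := by
          have : Continuous fun p : Eu n × Eu n => ‖u p.2 - u p.1‖ₑ := by fun_prop
          exact this.measurable
        exact this.lintegral_prod_right'
    _ ≤ av (k+1) (fun z => ‖u z - u x‖ₑ) x + 2^n * ((n * 2^n) * (((2:ℝ≥0∞)^k)⁻¹ * av k (fun y => ‖fderiv ℝ u y‖ₑ) x)) := by
        gcongr
        exact poinc hu k x
    _ = _ := by
        rw [show (4:ℝ≥0∞)^n = 2^n * 2^n by rw [← mul_pow]; norm_num]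
        ring

lemma tele {u : Eu n → ℝ} (hu : ContDiff ℝ 1 u) (x : Eu n) (N : ℕ) :
    av 0 (fun y => ‖u y - u x‖ₑ) x ≤ av N (fun y => ‖u y - u x‖ₑ) x +
      (n * 4^n) * ∑ k ∈ Finset.range N, ((2:ℝ≥0∞)^k)⁻¹ * av k (fun y => ‖fderiv ℝ u y‖ₑ) x := by
  induction N with
  | zero => simp
  | succ N ih =>
    refine ih.trans ?_
    rw [Finset.sum_range_succ, mul_add, add_comm (_ * Finset.sum _ _), ← add_assoc]
    gcongr
    exact tele_step hu N x

lemma av_small {u : Eu n → ℝ} (hu : Continuous u) (x : Eu n) {ε : ℝ} (hε : 0 < ε) :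
    ∃ N₀, ∀ N ≥ N₀, av N (fun y => ‖u y - u x‖ₑ) x ≤ ENNReal.ofReal ε := by
  obtain ⟨δ, hδ, h⟩ := Metric.continuous_iff.1 hu x ε hε
  have ht : Filter.Tendsto (fun k : ℕ => (n:ℝ) * ((2:ℝ)^k)⁻¹) Filter.atTop (nhds 0) := by
    have := (tendsto_pow_atTop_nhds_zero_of_lt_one (r := (1/2 : ℝ)) (by norm_num) (by norm_num)).const_mul (n:ℝ)
    simpa using this
  obtain ⟨N₀, hN⟩ := Filter.eventually_atTop.1 (ht.eventually (gt_mem_nhds hδ))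
  refine ⟨N₀, fun N hN' => ?_⟩
  refine (av_mono (g := fun _ => ENNReal.ofReal ε) fun y hy => ?_).trans_eq (av_const _ _ _)
  have h1 := (dy_dist hy (mem_dy_self N x)).trans_lt (hN N hN')
  have h2 := h y h1
  rw [Real.dist_eq] at h2
  rw [← ofReal_norm, Real.norm_eq_abs]
  exact ENNReal.ofReal_le_ofReal h2.le


lemma pow_aux (m : ℕ) : ((2:ℝ≥0∞)^m)⁻¹ * 4^m = 2^m := by
  rw [show (4:ℝ≥0∞) = 2 * 2 by norm_num, mul_pow, ← mul_assoc,
    ENNReal.inv_mul_cancel (by simp) (by simp), one_mul]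

lemma sum_low (e : ℕ → ℝ≥0∞) (K : ℝ≥0∞) (he : ∀ k, e k ≤ K * 4^k) (m : ℕ) :
    ∑ k ∈ Finset.range m, ((2:ℝ≥0∞)^k)⁻¹ * e k ≤ K * 2^m := by
  induction m with
  | zero => simp
  | succ m ih =>
    rw [Finset.sum_range_succ]
    calc _ ≤ K * 2^m + ((2:ℝ≥0∞)^m)⁻¹ * (K * 4^m) := by gcongr; exact he m
      _ = K * 2^m + K * (((2:ℝ≥0∞)^m)⁻¹ * 4^m) := by ring
      _ = _ := by rw [pow_aux]; ring

lemma sum_high (e : ℕ → ℝ≥0∞) (K : ℝ≥0∞) (m : ℕ) (he : ∀ k, m ≤ k → e k ≤ K * 4^m) (N : ℕ) :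
    ∑ i ∈ Finset.range N, ((2:ℝ≥0∞)^(m+i))⁻¹ * e (m+i) ≤ 2 * (K * 2^m) := by
  calc _ ≤ ∑ i ∈ Finset.range N, (K * 2^m) * (2⁻¹)^i := by
        refine Finset.sum_le_sum fun i _ => ?_
        calc ((2:ℝ≥0∞)^(m+i))⁻¹ * e (m+i) ≤ ((2:ℝ≥0∞)^(m+i))⁻¹ * (K * 4^m) := by
              gcongr; exact he _ (by omega)
          _ = K * (((2:ℝ≥0∞)^m)⁻¹ * 4^m) * (2⁻¹)^i := by
              rw [pow_add, ENNReal.mul_inv (by simp) (by simp), ENNReal.inv_pow (n := i)]; ring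
          _ = _ := by rw [pow_aux]
    _ = (K * 2^m) * ∑ i ∈ Finset.range N, (2⁻¹ : ℝ≥0∞)^i := by rw [Finset.mul_sum]
    _ ≤ (K * 2^m) * ∑' i : ℕ, (2⁻¹ : ℝ≥0∞)^i := by gcongr; exact ENNReal.sum_le_tsum _
    _ = _ := by rw [ENNReal.tsum_geometric, ENNReal.one_sub_inv_two, inv_inv, mul_comm]

lemma core_pt {u : Eu n → ℝ} (hu : ContDiff ℝ 1 u) (x : Eu n) (K : ℝ≥0∞) (m : ℕ)
    (h0 : av 0 (fun y => ‖u y‖ₑ) x ≤ K)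
    (he : ∀ k, av k (fun y => ‖fderiv ℝ u y‖ₑ) x ≤ K * 4^k)
    (he' : ∀ k, m ≤ k → av k (fun y => ‖fderiv ℝ u y‖ₑ) x ≤ K * 4^m) :
    ‖u x‖ₑ ≤ (1 + 3 * (n * 4^n)) * (K * 2^m) := by
  have hc := hu.continuous
  have h1 : ‖u x‖ₑ ≤ K + av 0 (fun y => ‖u y - u x‖ₑ) x := by
    calc ‖u x‖ₑ = av 0 (fun _ => ‖u x‖ₑ) x := (av_const _ _ _).symm
      _ ≤ av 0 (fun y => ‖u y‖ₑ + ‖u y - u x‖ₑ) x := by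
          refine av_mono fun y _ => ?_
          conv_lhs => rw [show u x = u y - (u y - u x) by ring]
          exact enorm_sub_le
      _ = _ := av_add (by fun_prop) x
      _ ≤ _ := by gcongr
  have h2 : av 0 (fun y => ‖u y - u x‖ₑ) x ≤ (n * 4^n) * (3 * (K * 2^m)) := by
    refine ENNReal.le_of_forall_pos_le_add fun ε hε _ => ?_
    obtain ⟨N₀, hN⟩ := av_small hc x (ε := ε) (by exact_mod_cast hε)
    have h3 := tele hu x (m + N₀)
    rw [Finset.sum_range_add] at h3
    refine h3.trans ?_
    rw [add_comm]
    have := hN (m + N₀) (by omega)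
    rw [ENNReal.ofReal_coe_nnreal] at this
    have hl := sum_low _ K he m
    have hh := sum_high _ K m he' N₀
    gcongr
    calc _ ≤ K * 2^m + 2 * (K * 2^m) := add_le_add hl hh
      _ = _ := by ring
  have h3 : K ≤ K * 2^m := le_mul_of_one_le_right' (one_le_pow₀ (by norm_num))
  calc _ ≤ K * 2^m + (n * 4^n) * (3 * (K * 2^m)) := h1.trans (add_le_add h3 h2)
    _ = _ := by ring

lemma exists_m (K M B : ℝ≥0∞) (hK : K ≠ 0) (hK' : K ≠ ⊤) (hB : B ≠ ⊤) (hM : M ≤ B) (j : ℕ) :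
    ∃ m, j ≤ m ∧ M ≤ K * 4^m ∧ (m = j ∨ K * 4^m ≤ 4 * M) := by
  classical
  have hex : ∃ m, j ≤ m ∧ M ≤ K * 4^m := by
    obtain ⟨a, ha⟩ := ENNReal.exists_nat_gt (ENNReal.div_ne_top hB hK)
    refine ⟨a + j, by omega, ?_⟩
    have h1 : B ≤ K * a := by
      rw [mul_comm]
      exact (ENNReal.div_le_iff hK hK').1 ha.le
    refine hM.trans (h1.trans ?_)
    gcongr
    calc (a : ℝ≥0∞) ≤ ((4^(a+j) : ℕ) : ℝ≥0∞) := by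
          exact_mod_cast (Nat.lt_pow_self (n := a) (a := 4) (by norm_num)).le.trans
            (Nat.pow_le_pow_right (by norm_num) (by omega))
      _ = _ := by push_cast; rfl
  refine ⟨Nat.find hex, (Nat.find_spec hex).1, (Nat.find_spec hex).2, ?_⟩
  by_cases h : Nat.find hex = j
  · exact Or.inl h
  · right
    have h1 := (Nat.find_spec hex).1
    have h2 := Nat.find_min hex (m := Nat.find hex - 1) (by omega)
    have h3 : ¬ (M ≤ K * 4^(Nat.find hex - 1)) := fun h' => h2 ⟨by omega, h'⟩
    push Not at h3
    obtain ⟨a, ha⟩ : ∃ a, Nat.find hex = a + 1 := ⟨Nat.find hex - 1, by omega⟩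
    rw [ha] at h3 ⊢
    simp only [Nat.add_sub_cancel] at h3
    calc _ = 4 * (K * 4^a) := by ring
      _ ≤ _ := by gcongr

lemma core {u : Eu n → ℝ} (hu : ContDiff ℝ 1 u) (x₀ : Eu n) (K : ℝ≥0∞) (hK : K ≠ 0) (hK' : K ≠ ⊤)
    (h0 : av 0 (fun y => ‖u y‖ₑ^2) x₀ ≤ K^2)
    (h1 : ∀ k, ∀ x ∈ dy 0 x₀, av k (fun y => ‖fderiv ℝ u y‖ₑ^2) x ≤ K^2 * 16^k) (j : ℕ) :
    av j (fun y => ‖u y‖ₑ^4) x₀ ≤ (65 * (1 + 3 * (n * 4^n))^4) * (K^4 * 16^j) := by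
  have hcf : Continuous (fderiv ℝ u) := hu.continuous_fderiv one_ne_zero
  have hc := hu.continuous
  set g : Eu n → ℝ≥0∞ := fun y => ‖fderiv ℝ u y‖ₑ with hg
  have hgm : Measurable g := hcf.enorm.measurable
  have hgb : ∃ B : ℝ≥0∞, B ≠ ⊤ ∧ ∀ x ∈ dy j x₀, g x ≤ B := by
    obtain ⟨C, hC⟩ := (isCompact_closedBall x₀ (n * ((2:ℝ)^j)⁻¹)).exists_bound_of_continuousOn
      hcf.continuousOn
    refine ⟨ENNReal.ofReal C, ENNReal.ofReal_ne_top, fun x hx => ?_⟩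
    rw [hg]
    simp only
    rw [← ofReal_norm]
    exact ENNReal.ofReal_le_ofReal (hC x (dy_dist hx (mem_dy_self j x₀)))
  obtain ⟨B, hB, hgB⟩ := hgb
  obtain ⟨M, hMm, hMB, hMav, hMint⟩ := doob j x₀ hgm hB hgB
  set c : ℝ≥0∞ := 1 + 3 * (n * 4^n) with hcdef
  have hpt : ∀ x ∈ dy j x₀, ‖u x‖ₑ^4 ≤ c^4 * (K^4 * 16^j + (16 * K^2) * M x^2) := by
    intro x hx
    have hx0 : x ∈ dy 0 x₀ := dy_anti (Nat.zero_le j) x₀ hx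
    obtain ⟨m, hjm, hm, hor⟩ := exists_m K (M x) B hK hK' hB (hMB x) j
    have he : ∀ k, av k g x ≤ K * 4^k := by
      intro k
      have h2 : (av k g x)^2 ≤ (K * 4^k)^2 := by
        refine (av_sq_le k hgm x).trans ((h1 k x hx0).trans_eq ?_)
        rw [mul_pow, ← pow_mul, mul_comm k, pow_mul]; norm_num
      exact (ENNReal.pow_le_pow_left_iff two_ne_zero).1 h2
    have ha0 : av 0 (fun y => ‖u y‖ₑ) x ≤ K := by
      rw [av_congr hx0]
      have h2 := (av_sq_le 0 (f := fun y => ‖u y‖ₑ) (by fun_prop) x₀).trans h0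
      exact (ENNReal.pow_le_pow_left_iff two_ne_zero).1 h2
    have h3 := core_pt hu x K m ha0 he (fun k hk => (hMav x hx k (hjm.trans hk)).trans hm)
    calc _ ≤ (c * (K * 2^m))^4 := pow_le_pow_left' h3 4
      _ = c^4 * (K^4 * 16^m) := by
          rw [mul_pow, mul_pow, ← pow_mul, mul_comm m, pow_mul]; norm_num
      _ ≤ _ := by
          gcongr
          rcases hor with rfl | h
          · exact le_self_add
          · calc K^4 * 16^m = K^2 * (K * 4^m)^2 := by
                  rw [mul_pow, ← pow_mul, mul_comm m, pow_mul]; norm_num; ring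
              _ ≤ K^2 * (4 * M x)^2 := by gcongr
              _ = (16 * K^2) * M x^2 := by ring
              _ ≤ _ := le_add_self
  calc _ ≤ av j (fun x => c^4 * (K^4 * 16^j + (16 * K^2) * M x^2)) x₀ := av_mono hpt
    _ = c^4 * (K^4 * 16^j + (16 * K^2) * av j (fun x => M x^2) x₀) := by
        rw [av_const_mul (by fun_prop), av_add measurable_const, av_const,
          av_const_mul (hMm.pow_const 2)]
    _ ≤ c^4 * (K^4 * 16^j + (16 * K^2) * (4 * (K^2 * 16^j))) := by
        gcongr
        calc _ ≤ 4 * av j (fun x => g x^2) x₀ := by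
              unfold av
              rw [mul_left_comm]
              gcongr
          _ ≤ _ := by gcongr; exact h1 j x₀ (mem_dy_self 0 x₀)
    _ = _ := by ring


lemma mem_Q0 {x : Eu n} : x ∈ dy 0 (0 : Eu n) ↔ ∀ i, x i ∈ Set.Ico (0:ℝ) 1 := by
  rw [mem_dy_iff]; simp

lemma Q0_sub : dy 0 (0 : Eu n) ⊆ unitCube n := by
  intro x hx i
  exact Set.Ico_subset_Icc_self (mem_Q0.1 hx i)

lemma Q0_ae : unitCube n =ᵐ[volume] dy 0 (0 : Eu n) := by
  have h1 : dy 0 (0 : Eu n) = (MeasurableEquiv.toLp 2 (Fin n → ℝ)).symm ⁻¹'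
      (Set.univ.pi fun _ => Set.Ico (0:ℝ) 1) := by
    ext y; rw [mem_Q0]; simp
  have h2 : unitCube n = (MeasurableEquiv.toLp 2 (Fin n → ℝ)).symm ⁻¹'
      (Set.Icc (fun _ => (0:ℝ)) (fun _ => 1)) := by
    ext y; simp only [unitCube, Set.mem_ofPred_eq, ← Set.pi_univ_Icc]
    simp [Pi.le_def, forall_and]
  rw [h1, h2]
  have h3 : (Set.univ.pi fun _ : Fin n => Set.Ico (0:ℝ) 1) =ᵐ[volume]
      Set.Icc (fun _ => (0:ℝ)) (fun _ => 1) := Measure.univ_pi_Ico_ae_eq_Icc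
  exact ((EuclideanSpace.volume_preserving_symm_measurableEquiv_toLp
    (Fin n)).quasiMeasurePreserving.preimage_ae_eq h3).symm

lemma pow_aux2 (hn : 4 ≤ n) (k : ℕ) :
    (2:ℝ≥0∞)^(k*n) * (((2:ℝ≥0∞)^k)⁻¹)^(n-4) = 16^k := by
  obtain ⟨d, rfl⟩ := Nat.exists_eq_add_of_le' hn
  rw [Nat.add_sub_cancel, pow_mul, pow_add, mul_assoc, mul_comm (_ ^ 4), ← mul_assoc, ← mul_pow,
    ENNReal.mul_inv_cancel (by simp) (by simp), one_pow, one_mul, ← pow_mul, mul_comm, pow_mul]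
  norm_num

lemma lowerA (hn : 4 ≤ n) {f : Eu n → ℝ≥0∞} (hf : Measurable f) (K : ℝ≥0∞)
    (h : ∀ y : Eu n, ∀ r : ℝ, 0 < r → r ≤ 1 →
      ∫⁻ z in ball y r ∩ unitCube n, f z ≤ K^2 * (ENNReal.ofReal r)^(n-4))
    (k : ℕ) (x : Eu n) (hx : x ∈ dy 0 (0 : Eu n)) :
    av k f x ≤ (2^(n*n) * K)^2 * 16^k := by
  have hb : ∀ y ∈ dy k x, av (k+n) f y ≤ 2^(n*n) * K^2 * 16^k := by
    intro y hy
    have hy0 : y ∈ dy 0 (0 : Eu n) := by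
      have := dy_anti (Nat.zero_le k) x hy
      rwa [dy_eq hx] at this
    have hsub : dy (k+n) y ⊆ ball y (((2:ℝ)^k)⁻¹) ∩ unitCube n := by
      intro z hz
      constructor
      · rw [mem_ball]
        refine (dy_dist hz (mem_dy_self _ y)).trans_lt ?_
        rw [pow_add, mul_inv, mul_left_comm]
        have : (n:ℝ) < 2^n := by exact_mod_cast Nat.lt_two_pow_self
        have h2 : (n:ℝ) * ((2:ℝ)^n)⁻¹ < 1 := by
          rw [← div_eq_mul_inv, div_lt_one (by positivity)]; exact this
        have h3 : (0:ℝ) < ((2:ℝ)^k)⁻¹ := by positivity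
        nlinarith
      · apply Q0_sub
        have := dy_anti (Nat.zero_le (k+n)) y hz
        rwa [dy_eq hy0] at this
    calc av (k+n) f y ≤ 2^((k+n)*n) * ∫⁻ z in ball y (((2:ℝ)^k)⁻¹) ∩ unitCube n, f z := by
          unfold av
          gcongr
      _ ≤ 2^((k+n)*n) * (K^2 * (ENNReal.ofReal (((2:ℝ)^k)⁻¹))^(n-4)) := by
          gcongr
          exact h y _ (by positivity) (inv_le_one_of_one_le₀ (one_le_pow₀ (by norm_num)))
      _ = 2^(n*n) * K^2 * (2^(k*n) * (((2:ℝ≥0∞)^k)⁻¹)^(n-4)) := by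
          rw [ENNReal.ofReal_inv_of_pos (by positivity), ENNReal.ofReal_pow (by norm_num)]
          simp only [ENNReal.ofReal_ofNat]
          rw [add_mul, pow_add]; ring
      _ = _ := by rw [pow_aux2 hn]
  have hD := dy_measurable k x
  have e1 : ∫⁻ y in dy k x, f y = ∫⁻ y in dy k x, av (k+n) f y := by
    have := av_int (k+n) hf (h := (dy k x).indicator 1) (measurable_one.indicator hD) (by
      intro a b hab
      have hab' : b ∈ dy k a := dy_anti (by omega) a hab
      have : b ∈ dy k x ↔ a ∈ dy k x := by
        constructor
        · intro hb; rw [← dy_eq hb]; exact mem_dy_symm hab'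
        · intro ha; rw [← dy_eq ha]; exact hab'
      by_cases ha : a ∈ dy k x
      · rw [Set.indicator_of_mem ha, Set.indicator_of_mem (this.2 ha)]; rfl
      · rw [Set.indicator_of_notMem ha, Set.indicator_of_notMem (fun h => ha (this.1 h))])
    rw [← lintegral_indicator hD, ← lintegral_indicator hD]
    have e : ∀ F : Eu n → ℝ≥0∞, (dy k x).indicator F = fun y => F y * (dy k x).indicator 1 y := by
      intro F; ext y
      by_cases hy : y ∈ dy k x <;> simp [hy]
    rw [e f, e (av (k+n) f)]
    exact this.symm
  calc av k f x = av k (av (k+n) f) x := by unfold av at *; rw [e1]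
    _ ≤ av k (fun _ => 2^(n*n) * K^2 * 16^k) x := av_mono hb
    _ = 2^(n*n) * K^2 * 16^k := av_const _ _ _
    _ ≤ _ := by
      rw [mul_pow]
      have h1 : (1:ℝ≥0∞) ≤ 2^(n*n) := one_le_pow₀ (by norm_num)
      have h2 : (2:ℝ≥0∞)^(n*n) ≤ (2^(n*n))^2 := le_self_pow₀ h1 (by norm_num)
      exact mul_le_mul_left (mul_le_mul_left h2 _) _

lemma upperB {f : Eu n → ℝ≥0∞} (hf : Measurable f) (A : ℝ≥0∞) (j : ℕ)
    (h : ∀ x ∈ dy 0 (0 : Eu n), av j f x ≤ A) (x₀ : Eu n) (r : ℝ) (hr : r ≤ ((2:ℝ)^j)⁻¹) (hr2 : ((2:ℝ)^j)⁻¹ ≤ 2 * r) :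
    ∫⁻ y in ball x₀ r ∩ unitCube n, f y ≤ A * volume (ball x₀ ((2*n+1) * r)) := by
  set S := ball x₀ r ∩ dy 0 (0 : Eu n)
  have hS : MeasurableSet S := measurableSet_ball.inter (dy_measurable _ _)
  have e1 : ∫⁻ y in ball x₀ r ∩ unitCube n, f y = ∫⁻ y, S.indicator f y := by
    rw [lintegral_indicator hS]
    exact setLIntegral_congr ((ae_eq_refl _).inter Q0_ae)
  rw [e1, ← av_int' j (hf.indicator hS)]
  calc _ ≤ ∫⁻ x, (ball x₀ ((2*n+1) * r)).indicator (fun _ => A) x := by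
        refine lintegral_mono fun x => ?_
        by_cases hz : ∃ y ∈ dy j x, y ∈ S
        · obtain ⟨y, hy, hyS⟩ := hz
          have hx0 : x ∈ dy 0 (0 : Eu n) := by
            have := dy_anti (Nat.zero_le j) y (mem_dy_symm hy)
            rwa [dy_eq hyS.2] at this
          have hxb : x ∈ ball x₀ ((2*n+1) * r) := by
            rw [mem_ball]
            have h1 := dy_dist (mem_dy_self j x) hy
            have h2 : dist y x₀ < r := hyS.1
            have h3 := dist_triangle x y x₀
            have h4 : (n:ℝ) * ((2:ℝ)^j)⁻¹ ≤ n * (2 * r) := by gcongr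
            linarith
          rw [Set.indicator_of_mem hxb]
          refine le_trans (av_mono fun y _ => ?_) (h x hx0)
          exact Set.indicator_le_self _ _ _
        · push Not at hz
          have : av j (S.indicator f) x = 0 := by
            refine le_antisymm ((av_mono (g := fun _ => 0) fun y hy => ?_).trans_eq (av_const _ _ _)) (zero_le)
            rw [Set.indicator_of_notMem (hz y hy)]
          rw [this]; exact zero_le
    _ = _ := lintegral_indicator_const measurableSet_ball A

lemma exists_j {r : ℝ} (h0 : 0 < r) (h1 : r ≤ 1) :
    ∃ j : ℕ, r ≤ ((2:ℝ)^j)⁻¹ ∧ ((2:ℝ)^j)⁻¹ ≤ 2 * r := by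
  obtain ⟨j, hj1, hj2⟩ := exists_nat_pow_near (x := r⁻¹) (y := 2) ((one_le_inv₀ h0).2 h1) (by norm_num)
  refine ⟨j, ?_, ?_⟩
  · rw [le_inv_comm₀ h0 (by positivity)]; exact hj1
  · rw [pow_succ] at hj2
    rw [inv_le_comm₀ (by positivity) (by positivity), mul_inv]
    linarith

noncomputable def cst (n : ℕ) : ℝ≥0∞ :=
  (65 * (1 + 3 * (n * 4^n))^4) * (2^(n*n))^4 * (ENNReal.ofReal ((2*n+1)^n) * volume (ball (0:Eu n) 1))

lemma cst_ne_top (n : ℕ) : cst n ≠ ⊤ := by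
  unfold cst
  have := (measure_ball_lt_top (μ := volume) (x := (0:Eu n)) (r := 1)).ne
  finiteness

lemma fourth (hn : 4 ≤ n) {u : Eu n → ℝ} (hu : ContDiff ℝ 1 u) (K : ℝ≥0∞) (hK : K ≠ 0) (hK' : K ≠ ⊤)
    (h0 : ∀ y : Eu n, ∀ r : ℝ, 0 < r → r ≤ 1 →
      ∫⁻ z in ball y r ∩ unitCube n, ‖u z‖ₑ^2 ≤ K^2 * (ENNReal.ofReal r)^(n-4))
    (h1 : ∀ y : Eu n, ∀ r : ℝ, 0 < r → r ≤ 1 →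
      ∫⁻ z in ball y r ∩ unitCube n, ‖fderiv ℝ u z‖ₑ^2 ≤ K^2 * (ENNReal.ofReal r)^(n-4))
    (x₀ : Eu n) (r : ℝ) (hr : 0 < r) (hr1 : r ≤ 1) :
    ∫⁻ z in ball x₀ r ∩ unitCube n, ‖u z‖ₑ^4 ≤ cst n * K^4 * (ENNReal.ofReal r)^(n-4) := by
  have hc := hu.continuous
  have hcf : Continuous (fderiv ℝ u) := hu.continuous_fderiv one_ne_zero
  obtain ⟨j, hj1, hj2⟩ := exists_j hr hr1
  have hm0 : Measurable fun z => ‖u z‖ₑ^2 := by fun_prop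
  have hm4 : Measurable fun z => ‖u z‖ₑ^4 := by fun_prop
  have hm1 : Measurable fun z => ‖fderiv ℝ u z‖ₑ^2 := hcf.enorm.measurable.pow_const 2
  have hA : ∀ x ∈ dy 0 (0 : Eu n), av j (fun y => ‖u y‖ₑ^4) x ≤
      (65 * (1 + 3 * (n * 4^n))^4) * ((2^(n*n) * K)^4 * 16^j) := by
    intro x hx
    refine core hu x (2^(n*n) * K) (by simp [hK]) (by finiteness) ?_ ?_ j
    · have := lowerA hn hm0 K h0 0 x hx
      simpa using this
    · intro k y hy
      rw [dy_eq hx] at hy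
      exact lowerA hn hm1 K h1 k y hy
  have hB := upperB hm4 _ j hA x₀ r hj1 hj2
  refine hB.trans ?_
  rw [Measure.addHaar_ball_of_pos _ _ (by positivity), finrank_euclideanSpace_fin, mul_pow (2*(n:ℝ)+1) r,
    ENNReal.ofReal_mul (by positivity)]
  have h16 : (16:ℝ≥0∞)^j * ENNReal.ofReal (r^n) ≤ (ENNReal.ofReal r)^(n-4) := by
    rw [← ENNReal.ofReal_pow hr.le, show (16:ℝ≥0∞) = ENNReal.ofReal 16 by simp,
      ← ENNReal.ofReal_pow (by norm_num), ← ENNReal.ofReal_mul (by positivity)]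
    apply ENNReal.ofReal_le_ofReal
    have e : r^n = r^(n-4) * r^4 := by rw [← pow_add]; congr 1; omega
    have : (16:ℝ)^j * r^4 ≤ 1 := by
      have h2 : (2:ℝ)^j * r ≤ 1 := by
        rw [mul_comm]
        have := mul_le_mul_of_nonneg_right hj1 (by positivity : (0:ℝ) ≤ 2^j)
        rwa [inv_mul_cancel₀ (by positivity)] at this
      calc (16:ℝ)^j * r^4 = (2^j * r)^4 := by
            rw [mul_pow, ← pow_mul, mul_comm j, pow_mul]; norm_num
        _ ≤ 1 := pow_le_one₀ (by positivity) h2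
    rw [e, mul_left_comm]
    exact mul_le_of_le_one_right (by positivity) this
  unfold cst
  calc _ = (65 * (1 + 3 * (n * 4^n))^4) * (2^(n*n))^4 * (ENNReal.ofReal ((2*n+1)^n) * volume (ball (0:Eu n) 1))
        * K^4 * (16^j * ENNReal.ofReal (r^n)) := by ring
    _ ≤ _ := by gcongr

lemma prod_est (hn : 4 ≤ n) {u v : Eu n → ℝ} (hu : ContDiff ℝ 1 u) (hv : ContDiff ℝ 1 v)
    (K L : ℝ≥0∞) (hK : K ≠ 0) (hK' : K ≠ ⊤) (hL : L ≠ 0) (hL' : L ≠ ⊤)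
    (h0 : ∀ y : Eu n, ∀ r : ℝ, 0 < r → r ≤ 1 →
      ∫⁻ z in ball y r ∩ unitCube n, ‖u z‖ₑ^2 ≤ K^2 * (ENNReal.ofReal r)^(n-4))
    (h1 : ∀ y : Eu n, ∀ r : ℝ, 0 < r → r ≤ 1 →
      ∫⁻ z in ball y r ∩ unitCube n, ‖fderiv ℝ u z‖ₑ^2 ≤ K^2 * (ENNReal.ofReal r)^(n-4))
    (h2 : ∀ y : Eu n, ∀ r : ℝ, 0 < r → r ≤ 1 →
      ∫⁻ z in ball y r ∩ unitCube n, ‖v z‖ₑ^2 ≤ L^2 * (ENNReal.ofReal r)^(n-4))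
    (h3 : ∀ y : Eu n, ∀ r : ℝ, 0 < r → r ≤ 1 →
      ∫⁻ z in ball y r ∩ unitCube n, ‖fderiv ℝ v z‖ₑ^2 ≤ L^2 * (ENNReal.ofReal r)^(n-4))
    (x₀ : Eu n) (r : ℝ) (hr : 0 < r) (hr1 : r ≤ 1) :
    ∫⁻ z in ball x₀ r ∩ unitCube n, ‖u z * v z‖ₑ^2 ≤ cst n * (K * L)^2 * (ENNReal.ofReal r)^(n-4) := by
  have hcu := hu.continuous
  have hcv := hv.continuous
  have a := fourth hn hu K hK hK' h0 h1 x₀ r hr hr1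
  have b := fourth hn hv L hL hL' h2 h3 x₀ r hr hr1
  set R := (ENNReal.ofReal r)^(n-4)
  set μ := volume.restrict (ball x₀ r ∩ unitCube n)
  have hH := ENNReal.lintegral_mul_le_Lp_mul_Lq μ Real.HolderConjugate.two_two
    (f := fun z => ‖u z‖ₑ^2) (g := fun z => ‖v z‖ₑ^2) (by fun_prop) (by fun_prop)
  have e : ∀ t : ℝ≥0∞, (t^2)^(2:ℝ) = t^4 := by
    intro t
    rw [← ENNReal.rpow_natCast, ← ENNReal.rpow_mul, ← ENNReal.rpow_natCast]; norm_num
  simp only [Pi.mul_apply, e] at hH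
  have e2 : ∀ t : ℝ≥0∞, (t^2)^(1/2:ℝ) = t := by
    intro t
    rw [← ENNReal.rpow_natCast, ← ENNReal.rpow_mul]; norm_num
  calc _ = ∫⁻ z, ‖u z‖ₑ^2 * ‖v z‖ₑ^2 ∂μ := by simp_rw [enorm_mul, mul_pow]
    _ ≤ _ := hH
    _ ≤ (cst n * K^4 * R)^(1/2:ℝ) * (cst n * L^4 * R)^(1/2:ℝ) := by gcongr
    _ = ((cst n * (K * L)^2 * R)^2)^(1/2:ℝ) := by
        rw [← ENNReal.mul_rpow_of_nonneg _ _ (by norm_num)]; congr 1; ring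
    _ = _ := e2 _


lemma int_eq {f : Eu n → ℝ} (hf : Continuous f) (x₀ : Eu n) (r : ℝ) :
    ENNReal.ofReal (∫ y in ball x₀ r ∩ unitCube n, |f y| ^ (2:ℝ)) =
      ∫⁻ y in ball x₀ r ∩ unitCube n, ‖f y‖ₑ^2 := by
  have hi : IntegrableOn (fun y => |f y| ^ (2:ℝ)) (ball x₀ r ∩ unitCube n) := by
    have hc : Continuous fun y => |f y| ^ (2:ℝ) := by
      simp only [Real.rpow_two]; fun_prop
    exact (hc.continuousOn.integrableOn_compact (isCompact_closedBall x₀ r)).mono_set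
      (Set.inter_subset_left.trans ball_subset_closedBall)
  rw [ofReal_integral_eq_lintegral_ofReal hi (Filter.Eventually.of_forall fun y => by positivity)]
  refine lintegral_congr fun y => ?_
  rw [Real.rpow_two, ENNReal.ofReal_pow (abs_nonneg _), ← Real.norm_eq_abs, ofReal_norm]

lemma term_iff (hn : 4 ≤ n) {f : Eu n → ℝ} (hf : Continuous f) (x₀ : Eu n) {r : ℝ} (hr : 0 < r)
    {S : ℝ} (hS : 0 ≤ S) :
    r ^ ((n : ℝ) * (1/((n:ℝ)/2) - 1/2)) *
      (∫ y in ball x₀ r ∩ unitCube n, |f y| ^ (2:ℝ)) ^ (1/2:ℝ) ≤ S ↔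
    ∫⁻ y in ball x₀ r ∩ unitCube n, ‖f y‖ₑ^2 ≤ ENNReal.ofReal S ^ 2 * (ENNReal.ofReal r)^(n-4) := by
  rw [← int_eq hf]
  have hI : 0 ≤ ∫ y in ball x₀ r ∩ unitCube n, |f y| ^ (2:ℝ) :=
    integral_nonneg fun y => by positivity
  set I := ∫ y in ball x₀ r ∩ unitCube n, |f y| ^ (2:ℝ)
  rw [← ENNReal.ofReal_pow hS, ← ENNReal.ofReal_pow hr.le, ← ENNReal.ofReal_mul (by positivity),
    ENNReal.ofReal_le_ofReal_iff (by positivity)]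
  have hn0 : (n:ℝ) ≠ 0 := by
    have : n ≠ 0 := by omega
    exact_mod_cast this
  rw [← pow_le_pow_iff_left₀ (by positivity) hS two_ne_zero, mul_pow, ← Real.sqrt_eq_rpow,
    Real.sq_sqrt hI, ← Real.rpow_natCast, ← Real.rpow_mul hr.le]
  have e : (n : ℝ) * (1/((n:ℝ)/2) - 1/2) * ((2:ℕ):ℝ) = -((n-4 : ℕ) : ℝ) := by
    push_cast [Nat.cast_sub hn]
    field_simp
    ring
  rw [e, Real.rpow_neg hr.le, Real.rpow_natCast, inv_mul_le_iff₀ (by positivity), mul_comm]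

lemma exists_bd (hn : 4 ≤ n) {f : Eu n → ℝ} (hf : Continuous f) :
    ∃ S : ℝ, 0 ≤ S ∧ ∀ (x₀ : Eu n) (r : Set.Ioc (0:ℝ) 1),
      (r:ℝ) ^ ((n : ℝ) * (1/((n:ℝ)/2) - 1/2)) *
        (∫ y in ball x₀ (r:ℝ) ∩ unitCube n, |f y| ^ (2:ℝ)) ^ (1/2:ℝ) ≤ S := by
  have hsub : unitCube n ⊆ closedBall (0 : Eu n) n := by
    intro x hx
    rw [mem_closedBall, dist_zero_right, EuclideanSpace.norm_eq]
    calc √(∑ i, ‖x i‖ ^ 2) ≤ √(∑ i : Fin n, (1:ℝ)) := by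
          refine Real.sqrt_le_sqrt (Finset.sum_le_sum fun i _ => ?_)
          have := hx i
          rw [Real.norm_eq_abs, sq_abs]
          exact pow_le_one₀ this.1 this.2
      _ = √n := by simp
      _ ≤ n := by
          rw [Real.sqrt_le_left (by positivity)]
          have : (1:ℝ) ≤ n := by exact_mod_cast (by omega : 1 ≤ n)
          nlinarith
  obtain ⟨B, hB⟩ := (isCompact_closedBall (0 : Eu n) n).exists_bound_of_continuousOn hf.continuousOn
  have hB0 : 0 ≤ B := (norm_nonneg _).trans (hB 0 (mem_closedBall_self (by positivity)))
  set ω := volume (ball (0 : Eu n) 1) with hω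
  have hωt : ω ≠ ⊤ := measure_ball_lt_top.ne
  refine ⟨B * (1 + ω.toReal), by positivity, fun x₀ r => ?_⟩
  rw [term_iff hn hf x₀ r.2.1 (by positivity)]
  have hr := r.2.1
  have hm : MeasurableSet (unitCube n) := by
    have : IsClosed (unitCube n) := by
      have : unitCube n = ⋂ i, {x : Eu n | x i ∈ Set.Icc (0:ℝ) 1} := by
        ext x; simp [unitCube]
      rw [this]
      exact isClosed_iInter fun i => isClosed_Icc.preimage (by fun_prop)
    exact this.measurableSet
  calc _ ≤ ∫⁻ y in ball x₀ (r:ℝ) ∩ unitCube n, ENNReal.ofReal B ^ 2 := by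
        refine setLIntegral_mono' (measurableSet_ball.inter hm) fun y hy => ?_
        gcongr
        rw [← ofReal_norm]
        exact ENNReal.ofReal_le_ofReal (hB y (hsub hy.2))
    _ = ENNReal.ofReal B ^ 2 * volume (ball x₀ (r:ℝ) ∩ unitCube n) := setLIntegral_const _ _
    _ ≤ ENNReal.ofReal B ^ 2 * (ENNReal.ofReal r ^ (n-4) * ω) := by
        gcongr
        refine (measure_mono Set.inter_subset_left).trans ?_
        rw [Measure.addHaar_ball_of_pos _ _ hr, finrank_euclideanSpace_fin, ENNReal.ofReal_pow hr.le]
        gcongr ?_ * _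
        exact pow_le_pow_right_of_le_one' (by simpa using r.2.2) (by omega)
    _ ≤ _ := by
        rw [ENNReal.ofReal_mul hB0, mul_pow, mul_assoc, mul_comm (_ ^ (n-4))]
        gcongr
        have h1 : ω ≤ ENNReal.ofReal (1 + ω.toReal) := by
          calc ω = ENNReal.ofReal ω.toReal := (ENNReal.ofReal_toReal hωt).symm
            _ ≤ _ := ENNReal.ofReal_le_ofReal (by linarith)
        have h2 : (1:ℝ≥0∞) ≤ ENNReal.ofReal (1 + ω.toReal) := by
          rw [← ENNReal.ofReal_one]
          exact ENNReal.ofReal_le_ofReal (by linarith [ENNReal.toReal_nonneg (a := ω)])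
        exact h1.trans (le_self_pow₀ h2 two_ne_zero)

lemma norm_le (f : Eu n → ℝ) {S : ℝ}
    (h : ∀ (x₀ : Eu n) (r : Set.Ioc (0:ℝ) 1),
      (r:ℝ) ^ ((n : ℝ) * (1/((n:ℝ)/2) - 1/2)) *
        (∫ y in ball x₀ (r:ℝ) ∩ unitCube n, |f y| ^ (2:ℝ)) ^ (1/2:ℝ) ≤ S) :
    morreyNorm n ((n:ℝ)/2) 2 (unitCube n) f ≤ S := by
  haveI : Nonempty (Set.Ioc (0:ℝ) 1) := ⟨⟨1, by norm_num, le_rfl⟩⟩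
  exact ciSup_le fun x₀ => ciSup_le fun r => h x₀ r

lemma le_norm (hn : 4 ≤ n) {f : Eu n → ℝ} (hf : Continuous f) (x₀ : Eu n) (r : Set.Ioc (0:ℝ) 1) :
      (r:ℝ) ^ ((n : ℝ) * (1/((n:ℝ)/2) - 1/2)) *
        (∫ y in ball x₀ (r:ℝ) ∩ unitCube n, |f y| ^ (2:ℝ)) ^ (1/2:ℝ) ≤
    morreyNorm n ((n:ℝ)/2) 2 (unitCube n) f := by
  haveI : Nonempty (Set.Ioc (0:ℝ) 1) := ⟨⟨1, by norm_num, le_rfl⟩⟩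
  obtain ⟨S, -, hS⟩ := exists_bd hn hf
  unfold morreyNorm
  refine le_trans ?_ (le_ciSup (f := fun x₀ : Eu n => ⨆ r : Set.Ioc (0:ℝ) 1,
    (r : ℝ) ^ ((n : ℝ) * (1/((n:ℝ)/2) - 1/2)) *
      (∫ y in Metric.ball x₀ (r : ℝ) ∩ unitCube n, |f y| ^ (2:ℝ)) ^ (1/2:ℝ)) ?_ x₀)
  · refine le_ciSup (f := fun r : Set.Ioc (0:ℝ) 1 =>
      (r : ℝ) ^ ((n : ℝ) * (1/((n:ℝ)/2) - 1/2)) *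
      (∫ y in Metric.ball x₀ (r : ℝ) ∩ unitCube n, |f y| ^ (2:ℝ)) ^ (1/2:ℝ)) ?_ r
    exact ⟨S, by rintro _ ⟨r, rfl⟩; exact hS x₀ r⟩
  · exact ⟨S, by rintro _ ⟨x, rfl⟩; exact ciSup_le fun r => hS x r⟩

lemma norm_nonneg' (f : Eu n → ℝ) : 0 ≤ morreyNorm n ((n:ℝ)/2) 2 (unitCube n) f := by
  refine Real.iSup_nonneg fun x₀ => Real.iSup_nonneg fun r => ?_
  have := r.2.1
  have : 0 ≤ ∫ y in ball x₀ (r:ℝ) ∩ unitCube n, |f y| ^ (2:ℝ) :=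
    integral_nonneg fun y => by positivity
  positivity

lemma hyp_of_norm (hn : 4 ≤ n) {f : Eu n → ℝ} (hf : Continuous f) {S : ℝ}
    (hS : morreyNorm n ((n:ℝ)/2) 2 (unitCube n) f ≤ S) (x₀ : Eu n) (r : ℝ) (hr : 0 < r) (hr1 : r ≤ 1) :
    ∫⁻ y in ball x₀ r ∩ unitCube n, ‖f y‖ₑ^2 ≤ ENNReal.ofReal S ^ 2 * (ENNReal.ofReal r)^(n-4) :=
  (term_iff hn hf x₀ hr ((norm_nonneg' f).trans hS)).1 ((le_norm hn hf x₀ ⟨r, hr, hr1⟩).trans hS)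

lemma main_eps (hn : 4 ≤ n) {u v : Eu n → ℝ} (hu : ContDiff ℝ 1 u) (hv : ContDiff ℝ 1 v)
    {ε : ℝ} (hε : 0 < ε) :
    morreyNorm n ((n:ℝ)/2) 2 (unitCube n) (fun x => u x * v x) ≤
      (1 + (cst n).toReal) * (morreySobolev1 n ((n:ℝ)/2) (unitCube n) u + ε) *
        (morreySobolev1 n ((n:ℝ)/2) (unitCube n) v + ε) := by
  have hcu := hu.continuous
  have hcv := hv.continuous
  have hcfu : Continuous (fderiv ℝ u) := hu.continuous_fderiv one_ne_zero
  have hcfv : Continuous (fderiv ℝ v) := hv.continuous_fderiv one_ne_zero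
  have p1 := norm_nonneg' u
  have p2 := norm_nonneg' v
  have p3 := norm_nonneg' (fun y => ‖fderiv ℝ u y‖)
  have p4 := norm_nonneg' (fun y => ‖fderiv ℝ v y‖)
  set K := morreySobolev1 n ((n:ℝ)/2) (unitCube n) u + ε with hKd
  set L := morreySobolev1 n ((n:ℝ)/2) (unitCube n) v + ε with hLd
  unfold morreySobolev1 at hKd hLd
  have hK : 0 < K := by linarith
  have hL : 0 < L := by linarith
  have q1 := hyp_of_norm hn hcu (S := K) (by linarith)
  have q2 := hyp_of_norm hn hcfu.norm (S := K) (by linarith)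
  have q3 := hyp_of_norm hn hcv (S := L) (by linarith)
  have q4 := hyp_of_norm hn hcfv.norm (S := L) (by linarith)
  simp only [enorm_norm] at q2 q4
  have hP := prod_est hn hu hv (ENNReal.ofReal K) (ENNReal.ofReal L) (by simpa using hK) (by simp)
    (by simpa using hL) (by simp) q1 q2 q3 q4
  refine norm_le _ fun x₀ r => ?_
  have hc0 : 0 ≤ (cst n).toReal := ENNReal.toReal_nonneg
  rw [term_iff hn (by fun_prop) x₀ r.2.1 (by positivity)]
  refine (hP x₀ r r.2.1 r.2.2).trans ?_
  rw [mul_assoc (1 + _), ENNReal.ofReal_mul (by positivity), ENNReal.ofReal_mul hK.le, mul_pow (ENNReal.ofReal (1 + _))]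
  gcongr
  have h1 : cst n ≤ ENNReal.ofReal (1 + (cst n).toReal) := by
    calc cst n = ENNReal.ofReal (cst n).toReal := (ENNReal.ofReal_toReal (cst_ne_top n)).symm
      _ ≤ _ := ENNReal.ofReal_le_ofReal (by linarith)
  have h2 : (1:ℝ≥0∞) ≤ ENNReal.ofReal (1 + (cst n).toReal) := by
    rw [← ENNReal.ofReal_one]
    exact ENNReal.ofReal_le_ofReal (by linarith)
  exact h1.trans (le_self_pow₀ h2 two_ne_zero)

end MorreyAux

/-- product estimate ‖uv‖_{M^{n/2}_2} ≤ C ‖u‖_{M^{n/2}_{2,1}} ‖v‖_{M^{n/2}_{2,1}}. -/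
theorem morrey_product_estimate (n : ℕ) (hn : 4 ≤ n) :
    ∃ C > 0, ∀ u v : EuclideanSpace ℝ (Fin n) → ℝ,
      ContDiff ℝ (⊤ : ℕ∞) u → ContDiff ℝ (⊤ : ℕ∞) v →
      morreyNorm n ((n : ℝ)/2) 2 (unitCube n) (fun x => u x * v x) ≤
        C * morreySobolev1 n ((n : ℝ)/2) (unitCube n) u
          * morreySobolev1 n ((n : ℝ)/2) (unitCube n) v := by
  refine ⟨1 + (MorreyAux.cst n).toReal, by positivity, fun u v hu hv => ?_⟩
  have hu1 : ContDiff ℝ 1 u := hu.of_le (by exact_mod_cast le_top)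
  have hv1 : ContDiff ℝ 1 v := hv.of_le (by exact_mod_cast le_top)
  have ht : Filter.Tendsto (fun ε : ℝ => (1 + (MorreyAux.cst n).toReal) *
      (morreySobolev1 n ((n:ℝ)/2) (unitCube n) u + ε) *
        (morreySobolev1 n ((n:ℝ)/2) (unitCube n) v + ε)) (nhdsWithin 0 (Set.Ioi 0))
      (nhds ((1 + (MorreyAux.cst n).toReal) *
      (morreySobolev1 n ((n:ℝ)/2) (unitCube n) u + 0) *
        (morreySobolev1 n ((n:ℝ)/2) (unitCube n) v + 0))) := by
    refine Filter.Tendsto.mono_left (Continuous.tendsto ?_ 0) nhdsWithin_le_nhds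
    fun_prop
  rw [add_zero, add_zero] at ht
  refine ge_of_tendsto ht ?_
  filter_upwards [self_mem_nhdsWithin] with ε hε
  exact MorreyAux.main_eps hn hu1 hv1 hε
end
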